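/- arXiv:1302.3448 — 2 statements merged into one kernel-verified Lean document; each statement's English description precedes it below -/
import Mathlib

section
/- Let ω ∈ ℝ \ {0} satisfy a·m − 2·M·r₊·ω = 0 and let λ ∈ ℝ satisfy λ + a²·ω² ≥ |m|·(|m|+1). Then there exist a real μ₀ with μ₀² > ω² and a nonzero function f : (r₊, ∞) → ℂ solving the radial ODE with parameters (ω, m, λ, μ₀), such that f extends to a C¹ function on [r₊, ∞) with f(r₊) ≠ 0 and f decays exponentially at infinity; that is, a real mode solution exists. -/
open Real Set MeasureTheory Filter Topology ComplexConjugate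

/-- The larger root `r₊ = M + √(M² − a²)`. -/
noncomputable def rPlus (M a : ℝ) : ℝ := M + Real.sqrt (M ^ 2 - a ^ 2)

/-- The smaller root `r₋ = M − √(M² − a²)`. -/
noncomputable def rMinus (M a : ℝ) : ℝ := M - Real.sqrt (M ^ 2 - a ^ 2)

/-- `Δ(r) = (r − r₊)(r − r₋)`. -/
noncomputable def Delta (M a r : ℝ) : ℝ := (r - rPlus M a) * (r - rMinus M a)

/-- The radial potential with real parameters `ω, λ, μ`. -/
noncomputable def Vpot (M a : ℝ) (m : ℤ) (ω lam μ r : ℝ) : ℝ :=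
  -(r ^ 2 + a ^ 2) ^ 2 * ω ^ 2 + 4 * M * a * m * r * ω - a ^ 2 * m ^ 2
    + Delta M a r * (lam + a ^ 2 * ω ^ 2 + μ ^ 2 * r ^ 2)

/-- The radial ODE `Δ (Δ R')' − V R = 0` on `(r₊, ∞)`. -/
def RadialODE (M a : ℝ) (m : ℤ) (ω lam μ : ℝ) (R : ℝ → ℂ) : Prop :=
  ∀ r ∈ Ioi (rPlus M a),
    (Delta M a r : ℂ) * deriv (fun s => (Delta M a s : ℂ) * deriv R s) r
      - (Vpot M a m ω lam μ r : ℂ) * R r = 0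

/-- Exponential decay at infinity of `h` together with its derivative. -/
def ExpDecay (rp : ℝ) (h : ℝ → ℂ) : Prop :=
  ∃ C c : ℝ, 0 < C ∧ 0 < c ∧ ∀ r : ℝ, rp + 1 ≤ r →
    ‖h r‖ + ‖deriv h r‖ ≤ C * Real.exp (-c * r)


noncomputable def wE (L x : ℝ) : ℝ := Real.exp (L * (|x| + x ^ 2 / 2))

noncomputable def Hop (d : ℝ) (q y : ℝ → ℝ) (t : ℝ) : ℝ :=
  (1 / (|t| + d)) * ∫ σ in (0:ℝ)..1, q (t * σ) * y (t * σ)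

noncomputable def Iop (d : ℝ) (q y : ℝ → ℝ) (x : ℝ) : ℝ := ∫ t in (0:ℝ)..x, Hop d q y t

lemma wE_pos (L x : ℝ) : 0 < wE L x := Real.exp_pos _

lemma wE_cont (L : ℝ) : Continuous (wE L) := by unfold wE; fun_prop

lemma wE_mono {L : ℝ} (hL : 0 ≤ L) {x y : ℝ} (hx : 0 ≤ x) (hxy : x ≤ y) : wE L x ≤ wE L y := by
  unfold wE
  rw [abs_of_nonneg hx, abs_of_nonneg (hx.trans hxy)]
  gcongr

lemma Hop_cont {d : ℝ} (hd : 0 < d) {q y : ℝ → ℝ} (hq : Continuous q) (hy : Continuous y) :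
    Continuous (Hop d q y) := by
  unfold Hop
  apply Continuous.mul
  · apply Continuous.div continuous_const (by fun_prop)
    intro x; positivity
  · apply intervalIntegral.continuous_parametric_intervalIntegral_of_continuous'
    fun_prop

lemma Iop_deriv {d : ℝ} (hd : 0 < d) {q y : ℝ → ℝ} (hq : Continuous q) (hy : Continuous y) (x : ℝ) :
    HasDerivAt (Iop d q y) (Hop d q y x) x :=
  (Hop_cont hd hq hy).integral_hasStrictDerivAt 0 x |>.hasDerivAt

lemma Hop_bound {d K N L : ℝ} (hd : 0 < d) (hK : 0 ≤ K) (hN : 0 ≤ N) (hL : 0 ≤ L) {q y : ℝ → ℝ}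
    (hqb : ∀ x, |q x| ≤ K * (1 + |x|) ^ 2) (hyb : ∀ x, |y x| ≤ N * wE L x) {t : ℝ} (ht : 0 ≤ t) :
    |Hop d q y t| ≤ (1 + 1 / d) * K * N * ((1 + t) * wE L t) := by
  have h1 : |∫ σ in (0:ℝ)..1, q (t * σ) * y (t * σ)| ≤ (K * (1 + t) ^ 2) * (N * wE L t) := by
    have := intervalIntegral.norm_integral_le_of_norm_le_const (a := (0:ℝ)) (b := 1)
      (f := fun σ => q (t * σ) * y (t * σ)) (C := (K * (1 + t) ^ 2) * (N * wE L t)) ?_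
    · simpa using this
    intro σ hσ
    rw [uIoc_of_le zero_le_one] at hσ
    have h0 : 0 ≤ t * σ := mul_nonneg ht hσ.1.le
    have h2 : t * σ ≤ t := mul_le_of_le_one_right ht hσ.2
    rw [Real.norm_eq_abs, abs_mul]
    have h3 := hqb (t * σ)
    rw [abs_of_nonneg h0] at h3
    apply mul_le_mul _ _ (abs_nonneg _) (by positivity)
    · exact h3.trans (by gcongr)
    · exact (hyb _).trans (by gcongr; exact wE_mono hL h0 h2)
  unfold Hop
  rw [abs_mul, abs_of_nonneg ht, abs_of_pos (by positivity : 0 < 1 / (t + d))]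
  have h4 : 1 / (t + d) * (1 + t) ≤ 1 + 1 / d := by
    rw [div_mul_eq_mul_div, div_le_iff₀ (by positivity)]
    have : (1 + 1 / d) * (t + d) = t + d + t / d + 1 := by field_simp; ring
    have := div_nonneg ht hd.le
    linarith
  have hw := wE_pos L t
  calc _ ≤ 1 / (t + d) * ((K * (1 + t) ^ 2) * (N * wE L t)) := by gcongr
    _ = (1 / (t + d) * (1 + t)) * (K * N * ((1 + t) * wE L t)) := by ring
    _ ≤ (1 + 1 / d) * (K * N * ((1 + t) * wE L t)) := by gcongr
    _ = _ := by ring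

lemma Iop_bound {d K N L : ℝ} (hd : 0 < d) (hK : 0 ≤ K) (hN : 0 ≤ N) (hL : 0 < L) {q y : ℝ → ℝ}
    (hqb : ∀ x, |q x| ≤ K * (1 + |x|) ^ 2) (hyb : ∀ x, |y x| ≤ N * wE L x) {x : ℝ} (hx : 0 ≤ x) :
    |Iop d q y x| ≤ ((1 + 1 / d) * K * N / L) * wE L x := by
  set c := (1 + 1 / d) * K * N with hc
  have hc0 : 0 ≤ c := by positivity
  have hcont : Continuous fun t : ℝ => c * ((1 + t) * Real.exp (L * (t + t ^ 2 / 2))) := by fun_prop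
  have h1 : |Iop d q y x| ≤ ∫ t in (0:ℝ)..x, c * ((1 + t) * Real.exp (L * (t + t ^ 2 / 2))) := by
    unfold Iop
    rw [← Real.norm_eq_abs]
    apply intervalIntegral.norm_integral_le_of_norm_le hx
    · filter_upwards with t ht
      have := Hop_bound hd hK hN hL.le hqb hyb ht.1.le
      rw [wE, abs_of_nonneg ht.1.le] at this
      exact this
    · exact hcont.intervalIntegrable _ _
  have h2 : ∫ t in (0:ℝ)..x, c * ((1 + t) * Real.exp (L * (t + t ^ 2 / 2)))
      = c / L * Real.exp (L * (x + x ^ 2 / 2)) - c / L * Real.exp (L * (0 + 0 ^ 2 / 2)) := by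
    apply intervalIntegral.integral_eq_sub_of_hasDerivAt
      (f := fun t => c / L * Real.exp (L * (t + t ^ 2 / 2)))
    · intro t _
      have : HasDerivAt (fun t : ℝ => L * (t + t ^ 2 / 2)) (L * (1 + t)) t := by
        have := ((hasDerivAt_id t).add (((hasDerivAt_id t).pow 2).div_const 2)).const_mul L
        refine this.congr_deriv ?_
        simp
      refine (this.exp.const_mul (c / L)).congr_deriv ?_
      field_simp
    · exact hcont.intervalIntegrable _ _
  rw [h2] at h1
  have : 0 ≤ c / L * Real.exp (L * (0 + 0 ^ 2 / 2)) := by positivity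
  rw [wE, abs_of_nonneg hx]
  linarith

lemma Iop_cont {d : ℝ} (hd : 0 < d) {q y : ℝ → ℝ} (hq : Continuous q) (hy : Continuous y) :
    Continuous (Iop d q y) :=
  continuous_iff_continuousAt.2 fun x => (Iop_deriv hd hq hy x).continuousAt

lemma Hop_sub {d : ℝ} {q y z : ℝ → ℝ} (hq : Continuous q) (hy : Continuous y)
    (hz : Continuous z) (t : ℝ) :
    Hop d q y t - Hop d q z t = Hop d q (fun x => y x - z x) t := by
  unfold Hop
  rw [← mul_sub, ← intervalIntegral.integral_sub]
  · simp only [mul_sub]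
  · exact Continuous.intervalIntegrable (by fun_prop) _ _
  · exact Continuous.intervalIntegrable (by fun_prop) _ _

lemma Hop_sub' {d : ℝ} {q r y : ℝ → ℝ} (hq : Continuous q) (hr : Continuous r)
    (hy : Continuous y) (t : ℝ) :
    Hop d q y t - Hop d r y t = Hop d (fun x => q x - r x) y t := by
  unfold Hop
  rw [← mul_sub, ← intervalIntegral.integral_sub]
  · simp only [sub_mul]
  · exact Continuous.intervalIntegrable (by fun_prop) _ _
  · exact Continuous.intervalIntegrable (by fun_prop) _ _

lemma Iop_sub {d : ℝ} (hd : 0 < d) {q y z : ℝ → ℝ} (hq : Continuous q) (hy : Continuous y)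
    (hz : Continuous z) (x : ℝ) :
    Iop d q y x - Iop d q z x = Iop d q (fun x => y x - z x) x := by
  unfold Iop
  rw [← intervalIntegral.integral_sub ((Hop_cont hd hq hy).intervalIntegrable _ _)
    ((Hop_cont hd hq hz).intervalIntegrable _ _)]
  simp only [Hop_sub hq hy hz]

lemma Iop_sub' {d : ℝ} (hd : 0 < d) {q r y : ℝ → ℝ} (hq : Continuous q) (hr : Continuous r)
    (hy : Continuous y) (x : ℝ) :
    Iop d q y x - Iop d r y x = Iop d (fun x => q x - r x) y x := by
  unfold Iop
  rw [← intervalIntegral.integral_sub ((Hop_cont hd hq hy).intervalIntegrable _ _)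
    ((Hop_cont hd hr hy).intervalIntegrable _ _)]
  simp only [Hop_sub' hq hr hy]

/-- the fixed point of the weighted Volterra operator -/
lemma exists_fix {d K L : ℝ} (hd : 0 < d) (hK : 0 ≤ K) (hL : 0 < L)
    (hKL : (1 + 1 / d) * K / L ≤ 1 / 2) {q : ℝ → ℝ}
    (hq : Continuous q) (hqb : ∀ x, |q x| ≤ K * (1 + |x|) ^ 2) :
    ∃ y : ℝ → ℝ, Continuous y ∧ (∃ N, 0 ≤ N ∧ ∀ x, |y x| ≤ N * wE L x) ∧
      ∀ x, y x = 1 + Iop d q y |x| := by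
  have hw0 : ∀ x, 0 < wE L x := wE_pos L
  have hwc := wE_cont L
  have hcont : ∀ u : BoundedContinuousFunction ℝ ℝ, Continuous fun x => u x * wE L x :=
    fun u => u.continuous.mul hwc
  have hb : ∀ u : BoundedContinuousFunction ℝ ℝ, ∀ x, |u x * wE L x| ≤ ‖u‖ * wE L x := by
    intro u x
    rw [abs_mul, abs_of_pos (hw0 x)]
    have := u.norm_coe_le_norm x
    rw [Real.norm_eq_abs] at this
    exact mul_le_mul_of_nonneg_right this (hw0 x).le
  have hone : ∀ x, 1 ≤ wE L x := by
    intro x; unfold wE; apply Real.one_le_exp; positivity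
  have habs : ∀ x, wE L |x| = wE L x := by intro x; unfold wE; simp
  have hI : ∀ (N : ℝ) (y : ℝ → ℝ), 0 ≤ N → (∀ x, |y x| ≤ N * wE L x) → ∀ x,
      |Iop d q y (|x|)| ≤ N / 2 * wE L x := by
    intro N y hN hy x
    have := Iop_bound hd hK hN hL hqb hy (abs_nonneg x)
    rw [habs] at this
    refine this.trans ?_
    have h3 : (1 + 1 / d) * K * N / L = ((1 + 1 / d) * K / L) * N := by ring
    rw [h3]
    have := hw0 x
    have : ((1 + 1 / d) * K / L) * N ≤ 1 / 2 * N := by gcongr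
    have : ((1 + 1 / d) * K / L) * N ≤ N / 2 := by linarith
    gcongr
  let F : BoundedContinuousFunction ℝ ℝ → BoundedContinuousFunction ℝ ℝ := fun u =>
    BoundedContinuousFunction.ofNormedAddCommGroup
      (fun x => (1 + Iop d q (fun x => u x * wE L x) |x|) / wE L x)
      (by
        apply Continuous.div _ hwc (fun x => (hw0 x).ne')
        exact continuous_const.add ((Iop_cont hd hq (hcont u)).comp continuous_abs))
      (1 + ‖u‖ / 2)
      (by
        intro x
        rw [Real.norm_eq_abs, abs_div, abs_of_pos (hw0 x), div_le_iff₀ (hw0 x)]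
        have h1 := hI _ _ (norm_nonneg u) (hb u) x
        have h2 := abs_add_le 1 (Iop d q (fun x => u x * wE L x) |x|)
        rw [abs_one] at h2
        have := hone x
        linarith)
  have hF : ContractingWith (1/2) F := by
    refine ⟨by rw [← NNReal.coe_lt_coe]; norm_num, LipschitzWith.of_dist_le_mul ?_⟩
    intro u v
    rw [dist_eq_norm u v]
    rw [BoundedContinuousFunction.dist_le (by positivity)]
    intro x
    change dist ((1 + Iop d q (fun x => u x * wE L x) |x|) / wE L x)
      ((1 + Iop d q (fun x => v x * wE L x) |x|) / wE L x) ≤ _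
    rw [Real.dist_eq, ← sub_div, abs_div, abs_of_pos (hw0 x), div_le_iff₀ (hw0 x),
      add_sub_add_left_eq_sub, Iop_sub hd hq (hcont u) (hcont v)]
    have := hI ‖u - v‖ (fun x => u x * wE L x - v x * wE L x) (norm_nonneg _) (by
      intro x
      have := hb (u - v) x
      simpa [sub_mul] using this) x
    refine this.trans (le_of_eq ?_)
    push_cast; ring
  obtain ⟨u, hu⟩ : ∃ u, F u = u := ⟨_, hF.fixedPoint_isFixedPt⟩
  refine ⟨fun x => u x * wE L x, hcont u, ⟨‖u‖, norm_nonneg u, hb u⟩, ?_⟩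
  intro x
  have h1 : F u x = u x := by rw [hu]
  change (1 + Iop d q (fun x => u x * wE L x) |x|) / wE L x = u x at h1
  rw [div_eq_iff (hw0 x).ne'] at h1
  exact h1.symm

/-- a-priori bound for a fixed point -/
lemma fix_bound {d K L : ℝ} (hd : 0 < d) (hK : 0 ≤ K) (hL : 0 < L)
    (hKL : (1 + 1 / d) * K / L ≤ 1 / 2) {q : ℝ → ℝ}
    (hqb : ∀ x, |q x| ≤ K * (1 + |x|) ^ 2) {y : ℝ → ℝ} {N : ℝ} (hN : 0 ≤ N)
    (hyb : ∀ x, |y x| ≤ N * wE L x) {c : ℝ} (hc : 0 ≤ c)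
    (hy : ∀ x, |y x| ≤ c * wE L x + |Iop d q y (|x|)|) (x : ℝ) :
    |y x| ≤ 2 * c * wE L x := by
  have habs : ∀ x, wE L |x| = wE L x := by intro x; unfold wE; simp
  -- improve the constant: infimum argument
  have himp : ∀ N, 0 ≤ N → (∀ x, |y x| ≤ N * wE L x) → ∀ x, |y x| ≤ (c + N / 2) * wE L x := by
    intro N hN h x
    have h1 := Iop_bound hd hK hN hL hqb h (abs_nonneg x)
    rw [habs] at h1
    have h3 : (1 + 1 / d) * K * N / L = ((1 + 1 / d) * K / L) * N := by ring
    rw [h3] at h1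
    have h4 : ((1 + 1 / d) * K / L) * N ≤ 1 / 2 * N := by gcongr
    have h5 := mul_le_mul_of_nonneg_right h4 (wE_pos L x).le
    linarith [hy x]
  have hind : ∀ n : ℕ, ∀ x, |y x| ≤ (2 * c + N / 2 ^ n) * wE L x := by
    intro n
    induction n with
    | zero =>
      intro x
      refine (hyb x).trans ?_
      have := wE_pos L x
      gcongr
      simp; linarith
    | succ n ih =>
      intro x
      refine (himp _ (by positivity) ih x).trans (le_of_eq ?_)
      rw [pow_succ]; field_simp; ring
  have hlim : Tendsto (fun n : ℕ => (2 * c + N / 2 ^ n) * wE L x) atTop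
      (𝓝 ((2 * c + 0) * wE L x)) := by
    apply Tendsto.mul_const
    apply Tendsto.const_add
    have := (tendsto_pow_atTop_nhds_zero_of_lt_one (r := (1/2:ℝ)) (by norm_num) (by norm_num)).const_mul N
    simp only [mul_zero] at this
    refine this.congr fun n => ?_
    rw [one_div, inv_pow]; rfl
  have := ge_of_tendsto' hlim (fun n => hind n x)
  simpa using this

/-- Regular solutions of `(x (x+d) f')' = q f`. -/
structure Sol (d : ℝ) (q f g : ℝ → ℝ) : Prop where
  f0 : f 0 = 1
  hf : ∀ x, HasDerivAt f (g x) x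
  hg : Continuous g
  hP : ∀ x, 0 < x → HasDerivAt (fun x => x * (x + d) * g x) (q x * f x) x

noncomputable def qf (p d A B E ε x : ℝ) : ℝ :=
  ε * (|x| + p) ^ 2 - A * (|x| + p) + B - E * (|x| / (|x| + d))

lemma qf_cont (p A B E ε : ℝ) {d : ℝ} (hd : 0 < d) : Continuous (qf p d A B E ε) := by
  unfold qf
  have : Continuous fun x : ℝ => |x| / (|x| + d) := by
    apply Continuous.div (by fun_prop) (by fun_prop)
    intro x; positivity
  fun_prop

lemma fix_sol {d : ℝ} (hd : 0 < d) {q y : ℝ → ℝ} (hq : Continuous q) (hyc : Continuous y)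
    (hy : ∀ x, y x = 1 + Iop d q y |x|) :
    Sol d q (fun x => 1 + Iop d q y x) (Hop d q y) := by
  refine ⟨by simp [Iop], fun x => (Iop_deriv hd hq hyc x).const_add 1, Hop_cont hd hq hyc, ?_⟩
  intro x hx
  have h1 : HasDerivAt (fun x => ∫ s in (0:ℝ)..x, q s * y s) (q x * y x) x :=
    ((hq.mul hyc).integral_hasStrictDerivAt 0 x).hasDerivAt
  have h2 : y x = 1 + Iop d q y x := by rw [hy x, abs_of_pos hx]
  rw [← h2]
  refine h1.congr_of_eventuallyEq ?_
  filter_upwards [lt_mem_nhds hx] with t ht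
  unfold Hop
  rw [abs_of_pos ht]
  have h3 := intervalIntegral.mul_integral_comp_mul_left (a := 0) (b := 1)
    (f := fun s => q s * y s) t
  simp only [mul_zero, mul_one] at h3
  rw [← h3]
  have : t + d ≠ 0 := by positivity
  field_simp

lemma qf_bound {p d A B E e1 ε : ℝ} (hp : 0 < p) (hd : 0 < d) (hA : 0 < A) (hE : 0 ≤ E)
    (h0 : 0 ≤ ε) (h1 : ε ≤ e1) (x : ℝ) :
    |qf p d A B E ε x| ≤ (e1 * (1 + p) ^ 2 + A * (1 + p) + |B| + E) * (1 + |x|) ^ 2 := by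
  unfold qf
  have hx := abs_nonneg x
  set t := |x|
  have ht1 : 0 ≤ t / (t + d) := by positivity
  have ht2 : t / (t + d) ≤ 1 := by rw [div_le_one (by positivity)]; linarith
  have a1 : t + p ≤ (1 + p) * (1 + t) := by nlinarith
  have a2 : (t + p) ^ 2 ≤ ((1 + p) * (1 + t)) ^ 2 := by gcongr
  have a3 : ε * (t + p) ^ 2 ≤ e1 * ((1 + p) * (1 + t)) ^ 2 := by gcongr; linarith
  have a4 : 1 ≤ (1 + t) ^ 2 := by nlinarith
  have a5 : A * (t + p) ≤ A * (1 + p) * (1 + t) ^ 2 := by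
    rw [mul_assoc]; gcongr; nlinarith
  have a6 : |B| ≤ |B| * (1 + t) ^ 2 := le_mul_of_one_le_right (abs_nonneg _) a4
  have a7 : E * (t / (t + d)) ≤ E * (1 + t) ^ 2 := by gcongr; linarith
  have a8 : 0 ≤ ε * (t + p) ^ 2 := by positivity
  have a9 : 0 ≤ A * (t + p) := by positivity
  have a10 : 0 ≤ E * (t / (t + d)) := by positivity
  have a11 := neg_abs_le B
  have a12 := le_abs_self B
  rw [abs_le]
  constructor <;> nlinarith

lemma exists_family {p d A B E e1 : ℝ} (hp : 0 < p) (hd : 0 < d) (hA : 0 < A) (hE : 0 ≤ E)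
    (he : 0 ≤ e1) : ∃ F G : ℝ → ℝ → ℝ,
      (∀ ε ∈ Icc 0 e1, Sol d (qf p d A B E ε) (F ε) (G ε)) ∧
      ∀ X, 0 ≤ X → ∃ C, 0 < C ∧ ∀ ε ∈ Icc 0 e1, ∀ ε' ∈ Icc 0 e1, ∀ x ∈ Icc 0 X,
        |F ε x - F ε' x| ≤ C * |ε - ε'| ∧ |G ε x - G ε' x| ≤ C * |ε - ε'| := by
  set K := e1 * (1 + p) ^ 2 + A * (1 + p) + |B| + E with hKdef
  have hK : 0 < K := by positivity
  set L := 2 * ((1 + 1 / d) * K) with hLdef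
  have hL : 0 < L := by positivity
  have hKL : (1 + 1 / d) * K / L ≤ 1 / 2 := by
    rw [hLdef, div_le_iff₀ (by positivity)]; linarith
  have hqc : ∀ ε, Continuous (qf p d A B E ε) := fun ε => qf_cont p A B E ε hd
  have hqb : ∀ ε ∈ Icc 0 e1, ∀ x, |qf p d A B E ε x| ≤ K * (1 + |x|) ^ 2 :=
    fun ε h x => qf_bound hp hd hA hE h.1 h.2 x
  have hex : ∀ ε, ∃ y : ℝ → ℝ, ε ∈ Icc 0 e1 → Continuous y ∧
      (∃ N, 0 ≤ N ∧ ∀ x, |y x| ≤ N * wE L x) ∧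
      ∀ x, y x = 1 + Iop d (qf p d A B E ε) y |x| := by
    intro ε
    by_cases h : ε ∈ Icc 0 e1
    · obtain ⟨y, hy⟩ := exists_fix hd hK.le hL hKL (hqc ε) (hqb ε h)
      exact ⟨y, fun _ => hy⟩
    · exact ⟨0, fun h' => absurd h' h⟩
  choose Y hY using hex
  have hone : ∀ x, 1 ≤ wE L x := by
    intro x; unfold wE; apply Real.one_le_exp; positivity
  have habs : ∀ x, wE L |x| = wE L x := by intro x; unfold wE; simp
  have hY2 : ∀ ε ∈ Icc 0 e1, ∀ x, |Y ε x| ≤ 2 * wE L x := by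
    intro ε hε x
    obtain ⟨hc, ⟨N, hN, hNb⟩, hfix⟩ := hY ε hε
    have := fix_bound hd hK.le hL hKL (hqb ε hε) hN hNb (c := 1) zero_le_one (by
      intro x
      have h1 := abs_add_le 1 (Iop d (qf p d A B E ε) (Y ε) (|x|))
      rw [← hfix x, abs_one] at h1
      linarith [hone x]) x
    simpa using this
  set c0 := 1 + 1 / d with hc0
  have hc0p : 0 < c0 := by positivity
  have hqd : ∀ ε ε' x, |qf p d A B E ε x - qf p d A B E ε' x| ≤
      (|ε - ε'| * (1 + p) ^ 2) * (1 + |x|) ^ 2 := by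
    intro ε ε' x
    have hx := abs_nonneg x
    have : qf p d A B E ε x - qf p d A B E ε' x = (ε - ε') * (|x| + p) ^ 2 := by
      unfold qf; ring
    rw [this, abs_mul, abs_of_nonneg (by positivity : (0:ℝ) ≤ (|x| + p) ^ 2), mul_assoc, ← mul_pow]
    gcongr
    nlinarith
  have hD : ∀ ε ∈ Icc 0 e1, ∀ ε' ∈ Icc 0 e1, ∀ x, |Y ε x - Y ε' x| ≤
      2 * (c0 * (|ε - ε'| * (1 + p) ^ 2) * 2 / L) * wE L x := by
    intro ε hε ε' hε' x
    obtain ⟨hc, -, hfix⟩ := hY ε hε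
    obtain ⟨hc', -, hfix'⟩ := hY ε' hε'
    refine fix_bound (y := fun x => Y ε x - Y ε' x) hd hK.le hL hKL (hqb ε hε) (N := 4)
      (by norm_num) ?_ (by positivity) ?_ x
    · intro x
      have h1 := abs_sub (Y ε x) (Y ε' x)
      linarith [hY2 ε hε x, hY2 ε' hε' x]
    · intro x
      have h1 : Y ε x - Y ε' x = Iop d (fun x => qf p d A B E ε x - qf p d A B E ε' x) (Y ε') (|x|)
          + Iop d (qf p d A B E ε) (fun x => Y ε x - Y ε' x) (|x|) := by
        rw [← Iop_sub hd (hqc ε) hc hc', ← Iop_sub' hd (hqc ε) (hqc ε') hc', hfix x, hfix' x]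
        ring
      rw [h1]
      refine (abs_add_le _ _).trans ?_
      gcongr
      have := Iop_bound hd (by positivity) (by norm_num : (0:ℝ) ≤ 2) hL (hqd ε ε') (hY2 ε' hε')
        (abs_nonneg x)
      rwa [habs] at this
  refine ⟨fun ε x => 1 + Iop d (qf p d A B E ε) (Y ε) x, fun ε => Hop d (qf p d A B E ε) (Y ε),
    fun ε hε => fix_sol hd (hqc ε) (hY ε hε).1 (hY ε hε).2.2, ?_⟩
  intro X hX
  set C1 := 2 * (c0 * (1 + p) ^ 2 * 2 / L) with hC1
  have hC1p : 0 < C1 := by positivity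
  set C2 := c0 * K * C1 + c0 * (1 + p) ^ 2 * 2 with hC2
  have hC2p : 0 < C2 := by positivity
  have hwX := wE_pos L X
  refine ⟨C1 * wE L X + C2 * ((1 + X) * wE L X), by positivity, ?_⟩
  intro ε hε ε' hε' x hx
  have hD' : ∀ x, |Y ε x - Y ε' x| ≤ (C1 * |ε - ε'|) * wE L x := by
    intro x
    refine (hD ε hε ε' hε' x).trans (le_of_eq ?_)
    rw [hC1]; ring
  have hwx := wE_mono hL.le hx.1 hx.2
  have hwx0 := wE_pos L x
  have hx0 := hx.1
  have hxX := hx.2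
  have hee := abs_nonneg (ε - ε')
  obtain ⟨hc, -, hfix⟩ := hY ε hε
  obtain ⟨hc', -, hfix'⟩ := hY ε' hε'
  constructor
  · have e1 := hfix x
    have e2 := hfix' x
    rw [abs_of_nonneg hx0] at e1 e2
    simp only
    rw [← e1, ← e2]
    refine (hD' x).trans ?_
    calc C1 * |ε - ε'| * wE L x ≤ C1 * |ε - ε'| * wE L X := by gcongr
      _ ≤ C1 * |ε - ε'| * wE L X + C2 * ((1 + X) * wE L X) * |ε - ε'| :=
        le_add_of_nonneg_right (by positivity)
      _ = _ := by ring
  · have h1 : Hop d (qf p d A B E ε) (Y ε) x - Hop d (qf p d A B E ε') (Y ε') x =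
        Hop d (fun x => qf p d A B E ε x - qf p d A B E ε' x) (Y ε') x
          + Hop d (qf p d A B E ε) (fun x => Y ε x - Y ε' x) x := by
      rw [← Hop_sub (hqc ε) hc hc', ← Hop_sub' (hqc ε) (hqc ε') hc']
      ring
    have h2 := Hop_bound hd (by positivity) (by norm_num : (0:ℝ) ≤ 2) hL.le (hqd ε ε')
      (hY2 ε' hε') hx0
    have h3 := Hop_bound hd hK.le (by positivity) hL.le (hqb ε hε) hD' hx0
    simp only
    rw [h1]
    refine (abs_add_le _ _).trans ((add_le_add h2 h3).trans ?_)
    calc _ = C2 * |ε - ε'| * ((1 + x) * wE L x) := by rw [hC2]; ring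
      _ ≤ C2 * |ε - ε'| * ((1 + X) * wE L X) := by gcongr
      _ ≤ C1 * wE L X * |ε - ε'| + C2 * |ε - ε'| * ((1 + X) * wE L X) :=
        le_add_of_nonneg_left (by positivity)
      _ = _ := by ring

lemma incr_aux {F F' : ℝ → ℝ} {a b : ℝ} (hab : a ≤ b) (hc : ContinuousOn F (Icc a b))
    (hd : ∀ x ∈ Ioo a b, HasDerivAt F (F' x) x) (h : ∀ x ∈ Ioo a b, 0 ≤ F' x) : F a ≤ F b := by
  have := monotoneOn_of_deriv_nonneg (convex_Icc a b) hc
    (by rw [interior_Icc]; exact fun x hx => (hd x hx).differentiableAt.differentiableWithinAt)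
    (by rw [interior_Icc]; intro x hx; rw [(hd x hx).deriv]; exact h x hx)
  exact this (left_mem_Icc.2 hab) (right_mem_Icc.2 hab) hab

lemma Sol.cont {d : ℝ} {q f g : ℝ → ℝ} (S : Sol d q f g) : Continuous f :=
  continuous_iff_continuousAt.2 fun x => (S.hf x).continuousAt

lemma Sol.contP {d : ℝ} {q f g : ℝ → ℝ} (S : Sol d q f g) :
    Continuous fun x => x * (x + d) * g x := by
  have := S.hg
  fun_prop

lemma Sol.pos {d : ℝ} (hd : 0 < d) {q f g : ℝ → ℝ} (S : Sol d q f g) {x0 : ℝ} (hx0 : 0 ≤ x0)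
    (hq : ∀ x, x0 ≤ x → 0 ≤ q x) (hf : 0 < f x0) (hg : 0 ≤ x0 * (x0 + d) * g x0) {x : ℝ}
    (hx : x0 ≤ x) : 0 < f x := by
  by_contra hneg
  push Not at hneg
  have hfc := S.cont
  have hcomp : IsCompact (Icc x0 x ∩ {t | f t ≤ 0}) :=
    isCompact_Icc.inter_right (isClosed_le hfc continuous_const)
  obtain ⟨z, ⟨⟨hz1, hz2⟩, hz3⟩, hz4⟩ := hcomp.exists_isLeast ⟨x, ⟨hx, le_refl x⟩, hneg⟩
  have hzp : ∀ t ∈ Ico x0 z, 0 < f t := by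
    intro t ht
    by_contra h
    push Not at h
    have := hz4 ⟨⟨ht.1, ht.2.le.trans hz2⟩, h⟩
    linarith [ht.2]
  have hPm : ∀ t ∈ Ioo x0 z, 0 ≤ g t := by
    intro t ht
    have ht0 : 0 < t := hx0.trans_lt ht.1
    have := incr_aux (F := fun x => x * (x + d) * g x) (F' := fun x => q x * f x) ht.1.le
      S.contP.continuousOn (fun s hs => S.hP s (hx0.trans_lt hs.1))
      (fun s hs => mul_nonneg (hq s hs.1.le) (hzp s ⟨hs.1.le, hs.2.trans ht.2⟩).le)
    have h2 : 0 ≤ t * (t + d) * g t := hg.trans this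
    exact nonneg_of_mul_nonneg_right h2 (by positivity)
  have := incr_aux (F := f) (F' := g) hz1 hfc.continuousOn (fun s _ => S.hf s) hPm
  have h3 : f z ≤ 0 := hz3
  linarith

lemma Sol.uniq {d : ℝ} (hd : 0 < d) {q f g : ℝ → ℝ} (S : Sol d q f g) (hq : Continuous q) {z : ℝ}
    (hz : 0 < z) (hf : f z = 0) (hg : g z = 0) : False := by
  have key : ∀ δ ∈ Ioo 0 z, f δ = 0 := by
    intro δ hδ
    have hcont : ContinuousOn (fun x => |1 / (x * (x + d)) + q x|) (Icc δ z) := by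
      apply ContinuousOn.abs
      apply ContinuousOn.add _ hq.continuousOn
      apply ContinuousOn.div continuousOn_const (by fun_prop)
      intro x hx
      have : 0 < x := hδ.1.trans_le hx.1
      positivity
    obtain ⟨C, hC⟩ := isCompact_Icc.bddAbove_image hcont
    have hC' : ∀ x ∈ Icc δ z, |1 / (x * (x + d)) + q x| ≤ C := fun x hx => hC ⟨x, hx, rfl⟩
    have hPc := S.contP
    have hfc := S.cont
    have := incr_aux (F := fun x => ((f x) ^ 2 + (x * (x + d) * g x) ^ 2) * Real.exp (C * x))
      (F' := fun x => (2 * f x * g x + 2 * (x * (x + d) * g x) * (q x * f x)) * Real.exp (C * x)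
        + ((f x) ^ 2 + (x * (x + d) * g x) ^ 2) * (Real.exp (C * x) * C)) hδ.2.le
      (by
        apply Continuous.continuousOn
        exact ((hfc.pow 2).add (hPc.pow 2)).mul (by fun_prop))
      (by
        intro x hx
        have hx0 : 0 < x := hδ.1.trans hx.1
        have h1 := ((S.hf x).pow 2).add ((S.hP x hx0).pow 2)
        have h2 : HasDerivAt (fun x => Real.exp (C * x)) (Real.exp (C * x) * C) x := by
          simpa using ((hasDerivAt_id x).const_mul C).exp
        refine (h1.mul h2).congr_deriv ?_
        simp)
      (by
        intro x hx
        have hx0 : 0 < x := hδ.1.trans hx.1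
        have hb := hC' x ⟨hx.1.le, hx.2.le⟩
        have hg : g x = (1 / (x * (x + d))) * (x * (x + d) * g x) := by
          have : x * (x + d) ≠ 0 := by positivity
          field_simp
        have hdd : 0 < x * (x + d) := by positivity
        generalize hP : x * (x + d) * g x = P at *
        have e : (2 * f x * g x + 2 * P * (q x * f x)) * Real.exp (C * x)
          + (f x ^ 2 + P ^ 2) * (Real.exp (C * x) * C)
          = Real.exp (C * x) * (2 * (f x * P) * (1 / (x * (x + d)) + q x) + C * (f x ^ 2 + P ^ 2)) := by
          rw [hg]; ring
        rw [e]
        apply mul_nonneg (Real.exp_pos _).le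
        have h5 : |2 * (f x * P)| ≤ f x ^ 2 + P ^ 2 := by
          rw [abs_le]; constructor <;> nlinarith [sq_nonneg (f x + P), sq_nonneg (f x - P)]
        have h6 : |2 * (f x * P) * (1 / (x * (x + d)) + q x)| ≤ (f x ^ 2 + P ^ 2) * C := by
          rw [abs_mul]
          exact mul_le_mul h5 hb (abs_nonneg _) (by positivity)
        linarith [neg_abs_le (2 * (f x * P) * (1 / (x * (x + d)) + q x))])
    simp only [hf, hg] at this
    have h7 : (f δ ^ 2 + (δ * (δ + d) * g δ) ^ 2) * Real.exp (C * δ) ≤ 0 := by simpa using this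
    have h8 : f δ ^ 2 + (δ * (δ + d) * g δ) ^ 2 ≤ 0 := by
      by_contra h
      push Not at h
      have := mul_pos h (Real.exp_pos (C * δ))
      linarith
    have : f δ ^ 2 = 0 := by nlinarith [sq_nonneg (f δ), sq_nonneg (δ * (δ + d) * g δ)]
    simpa using this
  have h1 : Tendsto f (𝓝[>] 0) (𝓝 (f 0)) := S.cont.continuousAt.tendsto.mono_left nhdsWithin_le_nhds
  have h2 : Tendsto f (𝓝[>] 0) (𝓝 0) := by
    refine tendsto_const_nhds.congr' ?_
    filter_upwards [Ioo_mem_nhdsGT hz] with x hx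
    exact (key x hx).symm
  have := tendsto_nhds_unique h1 h2
  rw [S.f0] at this
  exact one_ne_zero this

lemma Sol.pos_of_nonneg {d : ℝ} (hd : 0 < d) {q f g : ℝ → ℝ} (S : Sol d q f g) (hq : Continuous q)
    (hf : ∀ x, 0 ≤ x → 0 ≤ f x) {x : ℝ} (hx : 0 ≤ x) : 0 < f x := by
  rcases hx.eq_or_lt with rfl | hx
  · rw [S.f0]; exact one_pos
  rcases (hf x hx.le).eq_or_lt with h | h
  · exfalso
    apply S.uniq hd hq hx h.symm
    have : IsLocalMin f x := by
      filter_upwards [lt_mem_nhds hx] with t ht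
      rw [← h]; exact hf t ht.le
    exact this.hasDerivAt_eq_zero (S.hf x)
  · exact h

lemma Sol.osc {d : ℝ} (hd : 0 < d) {q f g : ℝ → ℝ} (S : Sol d q f g) (hq : Continuous q) {x1 : ℝ}
    (hx1 : d ≤ x1) (hq3 : ∀ x, x1 ≤ x → q x ≤ -3) : ∃ x, 0 ≤ x ∧ f x < 0 := by
  by_contra hcon
  push Not at hcon
  have hpos : ∀ x, 0 ≤ x → 0 < f x := fun x hx => S.pos_of_nonneg hd hq hcon hx
  have hfc := S.cont
  have hPc := S.contP
  have hx1p : 0 < x1 := hd.trans_le hx1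
  set N : ℝ → ℝ := fun x => -(x * (x + d) * g x) with hN
  have hNc : Continuous N := hPc.neg
  have hNd : ∀ x, 0 < x → HasDerivAt N (-(q x * f x)) x := fun x hx => (S.hP x hx).neg
  have hgN : ∀ x, 0 < x → g x = -(N x / (x * (x + d))) := by
    intro x hx
    have : x + d ≠ 0 := by positivity
    rw [hN]; field_simp
  -- first phase
  have ph1 : ∀ x, x1 ≤ x → N x1 / f x1 + 3 * (x - x1) ≤ N x / f x := by
    intro x hx
    have := incr_aux (F := fun x => N x / f x - 3 * x)
      (F' := fun x => ((-(q x * f x)) * f x - N x * g x) / (f x) ^ 2 - 3) hx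
      (by
        apply ContinuousOn.sub _ (by fun_prop)
        apply ContinuousOn.div hNc.continuousOn hfc.continuousOn
        intro t ht
        exact (hpos t (hx1p.le.trans ht.1)).ne')
      (by
        intro t ht
        have ht0 : 0 < t := hx1p.trans ht.1
        have h2 : HasDerivAt (fun x : ℝ => 3 * x) 3 t := by
          simpa using (hasDerivAt_id t).const_mul 3
        exact ((hNd t ht0).div (S.hf t) (hpos t ht0.le).ne').sub h2)
      (by
        intro t ht
        have ht0 : 0 < t := hx1p.trans ht.1
        have hft := hpos t ht0.le
        have hqt := hq3 t ht.1.le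
        rw [sub_nonneg, le_div_iff₀ (by positivity), hgN t ht0]
        have h3 : 0 ≤ N t * (N t / (t * (t + d))) := by
          rw [← mul_div_assoc]; apply div_nonneg (mul_self_nonneg _) (by positivity)
        have h4 : 3 * f t ^ 2 ≤ (-q t) * f t ^ 2 := by gcongr; linarith
        nlinarith)
    linarith
  -- choose x0 with N > 2 x f
  obtain ⟨x0, hx0, hx0'⟩ : ∃ x0, x1 ≤ x0 ∧ 2 * x0 < N x0 / f x0 := by
    refine ⟨x1 + |N x1 / f x1| + 2 * x1 + 1, ?_, ?_⟩
    · have := abs_nonneg (N x1 / f x1); linarith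
    · have h0 := abs_nonneg (N x1 / f x1)
      have := ph1 (x1 + |N x1 / f x1| + 2 * x1 + 1) (by linarith)
      have h2 := neg_abs_le (N x1 / f x1)
      linarith
  have hx0p : 0 < x0 := hx1p.trans_le hx0
  have hf0 := hpos x0 hx0p.le
  have hNx0 : 2 * x0 * f x0 < N x0 := by rwa [lt_div_iff₀ hf0] at hx0'
  have hNpos : ∀ x, x0 ≤ x → 0 < N x := by
    intro x hx
    have := incr_aux (F := N) (F' := fun x => -(q x * f x)) hx hNc.continuousOn
      (fun t ht => hNd t (hx0p.trans ht.1))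
      (by
        intro t ht
        have hft := hpos t (hx0p.trans ht.1).le
        have hqt := hq3 t (hx0.trans ht.1.le)
        nlinarith)
    have : 0 < 2 * x0 * f x0 := by positivity
    linarith
  have ph2 : ∀ x, x0 ≤ x → 1 / (2 * x0) - f x0 / N x0 ≤ 1 / (2 * x) - f x / N x := by
    intro x hx
    have := incr_aux (F := fun x => (1 / 2) * x⁻¹ - f x / N x)
      (F' := fun x => (1 / 2) * (-(x ^ 2)⁻¹) - (g x * N x - f x * (-(q x * f x))) / (N x) ^ 2) hx
      (by
        apply ContinuousOn.sub
        · apply ContinuousOn.mul continuousOn_const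
          apply ContinuousOn.inv₀ continuousOn_id
          intro t ht
          exact (hx0p.trans_le ht.1).ne'
        apply ContinuousOn.div hfc.continuousOn hNc.continuousOn
        intro t ht
        exact (hNpos t ht.1).ne')
      (by
        intro t ht
        have ht0 : 0 < t := hx0p.trans ht.1
        exact ((hasDerivAt_inv ht0.ne').const_mul (1 / 2)).sub
          ((S.hf t).div (hNd t ht0) (hNpos t ht.1.le).ne'))
      (by
        intro t ht
        have ht0 : 0 < t := hx0p.trans ht.1
        have hft := hpos t ht0.le
        have hNt := hNpos t ht.1.le
        have hqt := hq3 t (hx0.trans ht.1.le)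
        have e : (g t * N t - f t * (-(q t * f t))) / (N t) ^ 2
            = -(1 / (t * (t + d))) + q t * (f t ^ 2 / N t ^ 2) := by
          rw [hgN t ht0]; field_simp; ring
        rw [e]
        have h3 : q t * (f t ^ 2 / N t ^ 2) ≤ 0 :=
          mul_nonpos_of_nonpos_of_nonneg (by linarith) (by positivity)
        have h4 : (1 / 2) * (t ^ 2)⁻¹ ≤ 1 / (t * (t + d)) := by
          rw [one_div, ← mul_inv, one_div]
          apply inv_anti₀ (by positivity)
          nlinarith [ht.1]
        linarith)
    have e1 : ∀ x : ℝ, 1 / (2 * x) = 1 / 2 * x⁻¹ := by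
      intro x; rw [one_div, mul_inv, one_div]
    rw [e1, e1]
    exact this
  set κ := 1 / (2 * x0) - f x0 / N x0 with hκ
  have hκp : 0 < κ := by
    rw [hκ, sub_pos, div_lt_div_iff₀ (hNpos x0 le_rfl) (by positivity)]
    linarith
  have h9 := ph2 (x0 + 1 / κ) (by have : 0 < 1 / κ := by positivity
                                  linarith)
  have h10 : 0 < f (x0 + 1 / κ) / N (x0 + 1 / κ) := by
    have : x0 ≤ x0 + 1 / κ := by have : 0 < 1 / κ := by positivity
                                 linarith
    exact div_pos (hpos _ (by linarith)) (hNpos _ this)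
  have h11 : 1 / (2 * (x0 + 1 / κ)) ≤ κ := by
    rw [div_le_iff₀ (by positivity)]
    have : κ * (2 * (x0 + 1 / κ)) = 2 * κ * x0 + 2 := by field_simp
    rw [this]
    have : 0 < κ * x0 := by positivity
    linarith
  linarith

lemma Sol.decay {d : ℝ} (hd : 0 < d) {q f g : ℝ → ℝ} (S : Sol d q f g)
    (hpos : ∀ x, 0 ≤ x → 0 < f x) {x1 β : ℝ} (hx1 : d ≤ x1) (hβ : 0 < β)
    (hg : ∀ x, x1 ≤ x → g x ≤ 0) (hqb : ∀ x, x1 ≤ x → β ^ 2 * (x * (x + d)) ≤ q x) :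
    ∃ C c : ℝ, 0 < C ∧ 0 < c ∧ ∀ x, 0 ≤ x → |f x| + |g x| ≤ C * Real.exp (-c * x) := by
  have hfc := S.cont
  have hPc := S.contP
  have hx1p : 0 < x1 := hd.trans_le hx1
  have hexp : ∀ (b x : ℝ), HasDerivAt (fun x => Real.exp (b * x)) (Real.exp (b * x) * b) x := by
    intro b x
    simpa using ((hasDerivAt_id x).const_mul b).exp
  have hq0 : ∀ x, x1 ≤ x → 0 ≤ q x := by
    intro x hx
    have : 0 < x := hx1p.trans_le hx
    exact le_trans (by positivity) (hqb x hx)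
  have hfanti : ∀ x y, x1 ≤ x → x ≤ y → f y ≤ f x := by
    intro x y hx hxy
    have := incr_aux (F := fun x => -f x) (F' := fun x => -g x) hxy hfc.neg.continuousOn
      (fun t _ => (S.hf t).neg) (fun t ht => by linarith [hg t (hx.trans ht.1.le)])
    linarith
  set D : ℝ → ℝ := fun x => -(x * (x + d) * g x) - β * ((x * (x + d)) * f x) with hD
  have hDc : Continuous D := by
    apply hPc.neg.sub
    fun_prop
  have hDd : ∀ x, 0 < x → HasDerivAt D
      (-(q x * f x) - β * ((2 * x + d) * f x + (x * (x + d)) * g x)) x := by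
    intro x hx
    have h1 : HasDerivAt (fun x : ℝ => x * (x + d)) (2 * x + d) x := by
      refine ((hasDerivAt_id x).mul ((hasDerivAt_id x).add_const d)).congr_deriv ?_
      simp; ring
    exact (S.hP x hx).neg.sub ((h1.mul (S.hf x)).const_mul β)
  have hDmono : ∀ x y, x1 ≤ x → x ≤ y → D y * Real.exp (-β * y) ≤ D x * Real.exp (-β * x) := by
    intro x y hx hxy
    have := incr_aux (F := fun x => -(D x * Real.exp (-β * x)))
      (F' := fun x => -((-(q x * f x) - β * ((2 * x + d) * f x + (x * (x + d)) * g x))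
        * Real.exp (-β * x) + D x * (Real.exp (-β * x) * (-β)))) hxy
      (by apply Continuous.continuousOn
          apply (hDc.mul (by fun_prop)).neg)
      (by
        intro t ht
        have ht0 : 0 < t := hx1p.trans_le (hx.trans ht.1.le)
        exact ((hDd t ht0).mul (hexp (-β) t)).neg)
      (by
        intro t ht
        have ht1 := hx.trans ht.1.le
        have ht0 : 0 < t := hx1p.trans_le ht1
        have hft := hpos t ht0.le
        have e : -((-(q t * f t) - β * ((2 * t + d) * f t + (t * (t + d)) * g t))
            * Real.exp (-β * t) + D t * (Real.exp (-β * t) * (-β)))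
            = Real.exp (-β * t) * ((q t - β ^ 2 * (t * (t + d)) + β * (2 * t + d)) * f t) := by
          rw [hD]; ring
        rw [e]
        have h1 := hqb t ht1
        have h2 : 0 ≤ β * (2 * t + d) := by positivity
        exact mul_nonneg (Real.exp_pos _).le (mul_nonneg (by linarith) hft.le))
    linarith
  have hD0 : ∀ x, x1 ≤ x → 0 ≤ D x := by
    intro x0 hx0
    by_contra hneg
    push Not at hneg
    set κ := -(D x0 * Real.exp (-β * x0)) with hκ
    have hκp : 0 < κ := by
      have := mul_neg_of_neg_of_pos hneg (Real.exp_pos (-β * x0))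
      linarith
    have hF1 := hpos x1 hx1p.le
    have hlo := (isLittleO_pow_exp_pos_mul_atTop 2 hβ).bound
      (show 0 < κ / (4 * β * f x1) by positivity)
    obtain ⟨x, hxlo, hxx⟩ := (hlo.and (eventually_ge_atTop x0)).exists
    have hxx1 : x1 ≤ x := hx0.trans hxx
    have hxp : 0 < x := hx1p.trans_le hxx1
    have h1 := hDmono x0 x hx0 hxx
    have h2 : -(β * (x * (x + d) * f x)) ≤ D x := by
      have := hg x hxx1
      have h3 : x * (x + d) * g x ≤ 0 := mul_nonpos_of_nonneg_of_nonpos (by positivity) this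
      rw [hD]; simp only; linarith
    have h3 : f x ≤ f x1 := hfanti x1 x le_rfl hxx1
    have h4 : x * (x + d) * f x ≤ 2 * x ^ 2 * f x1 := by
      apply mul_le_mul _ h3 (hpos x hxp.le).le (by positivity)
      nlinarith
    rw [Real.norm_eq_abs, Real.norm_eq_abs, abs_of_nonneg (by positivity : 0 ≤ x ^ 2),
      abs_of_pos (Real.exp_pos _), div_mul_eq_mul_div, le_div_iff₀ (by positivity)] at hxlo
    have h5 : κ * Real.exp (β * x) ≤ -D x := by
      have h6 : κ ≤ -D x * Real.exp (-β * x) := by linarith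
      have h7 := mul_le_mul_of_nonneg_right h6 (Real.exp_pos (β * x)).le
      rw [mul_assoc, ← Real.exp_add] at h7
      simpa using h7
    have h8 : 0 < κ * Real.exp (β * x) := by positivity
    have h9 := mul_le_mul_of_nonneg_left h4 hβ.le
    nlinarith
  have hgb : ∀ x, x1 ≤ x → g x ≤ -(β * f x) := by
    intro x hx
    have hx0 : 0 < x := hx1p.trans_le hx
    have h := hD0 x hx
    have e : D x = (x * (x + d)) * (-(β * f x) - g x) := by rw [hD]; ring
    rw [e] at h
    have := nonneg_of_mul_nonneg_right h (by positivity)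
    linarith
  have hfdec : ∀ x, x1 ≤ x → f x ≤ f x1 * Real.exp (β * x1) * Real.exp (-β * x) := by
    intro x hx
    have := incr_aux (F := fun x => -(f x * Real.exp (β * x)))
      (F' := fun x => -(g x * Real.exp (β * x) + f x * (Real.exp (β * x) * β))) hx
      (by apply Continuous.continuousOn
          apply (hfc.mul (by fun_prop)).neg)
      (fun t _ => ((S.hf t).mul (hexp β t)).neg)
      (by
        intro t ht
        have h1 := hgb t ht.1.le
        have e : -(g t * Real.exp (β * t) + f t * (Real.exp (β * t) * β))
          = Real.exp (β * t) * (-(β * f t) - g t) := by ring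
        rw [e]
        exact mul_nonneg (Real.exp_pos _).le (by linarith))
    have h2 : f x * Real.exp (β * x) ≤ f x1 * Real.exp (β * x1) := by
      linarith
    have h3 := mul_le_mul_of_nonneg_right h2 (Real.exp_pos (-β * x)).le
    rw [mul_assoc, ← Real.exp_add] at h3
    simpa using h3
  have hgdec : ∀ x, x1 + 1 ≤ x → -g x ≤ f (x - 1) := by
    intro x hx
    obtain ⟨ξ, hξ, hξ2⟩ := exists_hasDerivAt_eq_slope f g (show x - 1 < x by linarith)
      hfc.continuousOn (fun t _ => S.hf t)
    have hξ1 : x1 ≤ ξ := by linarith [hξ.1]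
    have hξ0 : 0 < ξ := hx1p.trans_le hξ1
    have hx0 : 0 < x := by linarith
    have hfx := hpos x hx0.le
    have hP := incr_aux (F := fun x => x * (x + d) * g x) (F' := fun x => q x * f x) hξ.2.le
      hPc.continuousOn (fun t ht => S.hP t (hξ0.trans ht.1))
      (fun t ht => mul_nonneg (hq0 t (hξ1.trans ht.1.le)) (hpos t (hξ0.trans ht.1).le).le)
    have h1 : -g x ≤ -g ξ := by
      have hgx := hg x (by linarith)
      have h2 : ξ * (ξ + d) ≤ x * (x + d) := by
        have := hξ.2.le
        gcongr
      have h3 : ξ * (ξ + d) * (-g x) ≤ x * (x + d) * (-g x) :=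
        mul_le_mul_of_nonneg_right h2 (by linarith)
      have h4 : ξ * (ξ + d) * (-g x) ≤ ξ * (ξ + d) * (-g ξ) := by
        linarith
      exact le_of_mul_le_mul_left h4 (by positivity)
    have h5 : g ξ = f x - f (x - 1) := by rw [hξ2]; simp
    linarith
  obtain ⟨C', hC'⟩ := isCompact_Icc.bddAbove_image (K := Icc 0 (x1 + 1))
    (f := fun x => (|f x| + |g x|) * Real.exp (β * x))
    (by have := S.hg
        apply Continuous.continuousOn; fun_prop)
  have hC'' : ∀ x ∈ Icc 0 (x1 + 1), (|f x| + |g x|) * Real.exp (β * x) ≤ C' :=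
    fun x hx => hC' ⟨x, hx, rfl⟩
  have hF1 := hpos x1 hx1p.le
  set C0 := f x1 * Real.exp (β * x1) with hC0
  have hC0p : 0 < C0 := by positivity
  refine ⟨C0 * (1 + Real.exp β) + |C'|, β, by positivity, hβ, ?_⟩
  intro x hx
  rcases le_total x (x1 + 1) with h | h
  · have h1 := (hC'' x ⟨hx, h⟩).trans (le_abs_self C')
    have h3 := mul_le_mul_of_nonneg_right h1 (Real.exp_pos (-β * x)).le
    rw [mul_assoc, ← Real.exp_add] at h3
    have h4 : |f x| + |g x| ≤ |C'| * Real.exp (-β * x) := by simpa using h3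
    have : 0 ≤ C0 * (1 + Real.exp β) * Real.exp (-β * x) := by positivity
    linarith
  · have h1 := hfdec x (by linarith)
    have h2 := hfdec (x - 1) (by linarith)
    have h3 := hgdec x h
    have e : Real.exp (-β * (x - 1)) = Real.exp β * Real.exp (-β * x) := by
      rw [← Real.exp_add]; congr 1; ring
    rw [e] at h2
    rw [abs_of_pos (hpos x hx), abs_of_nonpos (hg x (by linarith))]
    have : 0 ≤ |C'| * Real.exp (-β * x) := by positivity
    linarith

lemma core {p d A B E : ℝ} (hp : 0 < p) (hd : 0 < d) (hA : 0 < A) (hE : 0 ≤ E) :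
    ∃ ε f g, 0 < ε ∧ Sol d (qf p d A B E ε) f g ∧
      (∀ x, 0 ≤ x → 0 < f x) ∧
      ∃ C c : ℝ, 0 < C ∧ 0 < c ∧ ∀ x, 0 ≤ x → |f x| + |g x| ≤ C * Real.exp (-c * x) := by
  have hBn := abs_nonneg B
  have hB1 := neg_abs_le B
  have hB2 := le_abs_self B
  set e1 := A / p + (|B| + E) / p ^ 2 with he1
  have he1p : 0 < e1 := by positivity
  obtain ⟨F, G, hS, hLip⟩ := exists_family (B := B) hp hd hA hE he1p.le
  have hqc : ∀ ε, Continuous (qf p d A B E ε) := fun ε => qf_cont p A B E ε hd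
  have hfrac : ∀ x : ℝ, 0 ≤ E * (|x| / (|x| + d)) ∧ E * (|x| / (|x| + d)) ≤ E := by
    intro x
    constructor
    · positivity
    · apply mul_le_of_le_one_right hE
      rw [div_le_one (by positivity)]; linarith
  -- at e1 the potential is nonnegative
  have hq1 : ∀ x, 0 ≤ qf p d A B E e1 x := by
    intro x
    unfold qf
    have hx := abs_nonneg x
    have h1 := (hfrac x).2
    have h2 : A * (|x| + p) ≤ A / p * (|x| + p) ^ 2 := by
      have e : A / p * (|x| + p) ^ 2 = A * (|x| + p) * ((|x| + p) / p) := by ring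
      rw [e]
      apply le_mul_of_one_le_right (by positivity)
      rw [one_le_div hp]; linarith
    have h3 : |B| + E ≤ (|B| + E) / p ^ 2 * (|x| + p) ^ 2 := by
      have e : (|B| + E) / p ^ 2 * (|x| + p) ^ 2 = (|B| + E) * ((|x| + p) ^ 2 / p ^ 2) := by ring
      rw [e]
      apply le_mul_of_one_le_right (by positivity)
      rw [one_le_div (by positivity)]
      gcongr; linarith
    rw [he1, add_mul]
    linarith
  set T : Set ℝ := {ε | ε ∈ Icc 0 e1 ∧ ∃ x, 0 ≤ x ∧ F ε x < 0} with hT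
  have hopen : ∀ ε ∈ T, ∃ δ > 0, ∀ ε' ∈ Icc 0 e1, |ε' - ε| ≤ δ → ε' ∈ T := by
    rintro ε ⟨hε, x, hx, hneg⟩
    obtain ⟨C, hC, hCb⟩ := hLip x hx
    refine ⟨-F ε x / (2 * C), div_pos (by linarith) (by positivity), ?_⟩
    intro ε' hε' hdist
    refine ⟨hε', x, hx, ?_⟩
    have h1 := (hCb ε' hε' ε hε x ⟨hx, le_rfl⟩).1
    rw [le_div_iff₀ (by positivity)] at hdist
    have h2 := le_abs_self (F ε' x - F ε x)
    linarith
  have h0T : (0:ℝ) ∈ T := by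
    refine ⟨⟨le_rfl, he1p.le⟩, ?_⟩
    refine (hS 0 ⟨le_rfl, he1p.le⟩).osc hd (hqc 0) (x1 := d + (|B| + 3) / A)
      (by have : 0 ≤ (|B| + 3) / A := by positivity
          linarith) ?_
    intro x hx
    have hx0 : 0 ≤ x := by
      have : 0 ≤ (|B| + 3) / A := by positivity
      linarith
    unfold qf
    have h1 := (hfrac x).1
    rw [abs_of_nonneg hx0] at h1 ⊢
    have h2 : (|B| + 3) / A ≤ x := by linarith
    rw [div_le_iff₀ hA] at h2
    have : 0 < A * p := by positivity
    linarith
  have h1T : e1 ∉ T := by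
    rintro ⟨he, x, hx, hneg⟩
    have := (hS e1 he).pos hd le_rfl (fun x _ => hq1 x) (by rw [(hS e1 he).f0]; exact one_pos)
      (by simp) hx
    linarith
  have hbdd : BddAbove T := ⟨e1, fun ε h => h.1.2⟩
  set ε0 := sSup T with hε0
  have hε0le : ε0 ≤ e1 := csSup_le ⟨0, h0T⟩ fun ε h => h.1.2
  have hε0pos : 0 < ε0 := by
    obtain ⟨δ, hδ, h⟩ := hopen 0 h0T
    have hm : 0 < min δ e1 := lt_min hδ he1p
    have := h (min δ e1) ⟨hm.le, min_le_right _ _⟩ (by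
      rw [sub_zero, abs_of_pos hm]; exact min_le_left _ _)
    exact hm.trans_le (le_csSup hbdd this)
  have hmem : ε0 ∈ Icc 0 e1 := ⟨hε0pos.le, hε0le⟩
  have hnot : ε0 ∉ T := by
    intro hin
    have hlt : ε0 < e1 := lt_of_le_of_ne hε0le (fun h => h1T (h ▸ hin))
    obtain ⟨δ, hδ, h⟩ := hopen ε0 hin
    have hm : 0 < min δ (e1 - ε0) := lt_min hδ (by linarith)
    have hm2 := min_le_right δ (e1 - ε0)
    have := h (ε0 + min δ (e1 - ε0)) ⟨by linarith, by linarith⟩ (by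
      rw [add_sub_cancel_left, abs_of_pos hm]; exact min_le_left _ _)
    have := le_csSup hbdd this
    linarith
  have S0 := hS ε0 hmem
  have hpos : ∀ x, 0 ≤ x → 0 < F ε0 x := by
    intro x hx
    apply S0.pos_of_nonneg hd (hqc ε0) _ hx
    intro t ht
    by_contra h
    push Not at h
    exact hnot ⟨hmem, t, ht, h⟩
  set x1 := d + 1 + 4 * (A + |B| + E) / ε0 with hx1
  have hx1' : 0 ≤ 4 * (A + |B| + E) / ε0 := by positivity
  have hql : ∀ ε, ε0 / 2 ≤ ε → ∀ x, x1 ≤ x → ε0 / 4 * x ^ 2 ≤ qf p d A B E ε x := by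
    intro ε hε x hx
    have hx0 : 0 ≤ x := by linarith
    unfold qf
    have h1 := (hfrac x).2
    rw [abs_of_nonneg hx0] at h1 ⊢
    have h2 : 4 * (A + |B| + E) / ε0 ≤ x + p := by linarith
    rw [div_le_iff₀ hε0pos] at h2
    have h3 : 1 ≤ x + p := by linarith
    set r := x + p
    have h4 : (A + |B| + E) * r ≤ ε0 / 4 * r ^ 2 := by nlinarith
    have h5 : ε0 / 2 * r ^ 2 ≤ ε * r ^ 2 := by gcongr
    have h6 : |B| + E ≤ (|B| + E) * r := le_mul_of_one_le_right (by positivity) h3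
    have h7 : ε0 / 4 * x ^ 2 ≤ ε0 / 4 * r ^ 2 := by
      gcongr; linarith
    linarith
  refine ⟨ε0, F ε0, G ε0, hε0pos, S0, hpos, ?_⟩
  have hβ : 0 < Real.sqrt (ε0 / 8) := Real.sqrt_pos.2 (by positivity)
  refine S0.decay hd hpos (x1 := x1) (β := Real.sqrt (ε0 / 8)) (by linarith) hβ ?_ ?_
  · intro x2 hx2
    by_contra hgpos
    push Not at hgpos
    have hx20 : 0 ≤ x2 := by linarith
    obtain ⟨C, hC, hCb⟩ := hLip x2 hx20
    obtain ⟨z, hz, hzmin⟩ := isCompact_Icc.exists_isMinOn (⟨0, le_rfl, hx20⟩ : (Icc 0 x2).Nonempty)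
      S0.cont.continuousOn
    have hm0 := hpos z hz.1
    set δ := min (ε0 / 2) (min (F ε0 z / (2 * C)) (G ε0 x2 / (2 * C))) with hδ
    have hδp : 0 < δ := by
      apply lt_min (by positivity)
      apply lt_min <;> positivity
    have hδ1 : δ ≤ ε0 / 2 := min_le_left _ _
    have hδ2 : δ ≤ F ε0 z / (2 * C) := (min_le_right _ _).trans (min_le_left _ _)
    have hδ3 : δ ≤ G ε0 x2 / (2 * C) := (min_le_right _ _).trans (min_le_right _ _)
    rw [le_div_iff₀ (by positivity)] at hδ2 hδ3
    obtain ⟨ε, hεT, hεlt⟩ := exists_lt_of_lt_csSup ⟨0, h0T⟩ (show ε0 - δ < sSup T by linarith)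
    have hεle : ε ≤ ε0 := le_csSup hbdd hεT
    obtain ⟨hεm, x, hx, hneg⟩ := hεT
    have habs : |ε - ε0| ≤ δ := by rw [abs_le]; constructor <;> linarith
    have hCabs : C * |ε - ε0| ≤ C * δ := by gcongr
    have Sε := hS ε hεm
    have hFpos : ∀ t ∈ Icc 0 x2, 0 < F ε t := by
      intro t ht
      have h1 := (hCb ε hεm ε0 hmem t ht).1
      have h2 := neg_abs_le (F ε t - F ε0 t)
      have h3 : F ε0 z ≤ F ε0 t := hzmin ht
      linarith
    have hGpos : 0 < G ε x2 := by
      have h1 := (hCb ε hεm ε0 hmem x2 ⟨hx20, le_rfl⟩).2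
      have h2 := neg_abs_le (G ε x2 - G ε0 x2)
      linarith
    rcases le_total x x2 with h | h
    · linarith [hFpos x ⟨hx, h⟩]
    · have := Sε.pos hd hx20
        (fun t ht => le_trans (by positivity) (hql ε (by linarith) t (hx2.trans ht)))
        (hFpos x2 ⟨hx20, le_rfl⟩) (by positivity) h
      linarith
  · intro x hx
    refine le_trans ?_ (hql ε0 (by linarith) x hx)
    rw [Real.sq_sqrt (by positivity)]
    have hx0 : d ≤ x := by linarith
    nlinarith [mul_nonneg hε0pos.le (mul_nonneg (hd.le.trans hx0) (sub_nonneg.2 hx0))]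

/-- existence of a real mode solution: for `ω ≠ 0` with `a m − 2 M r₊ ω = 0`
and an admissible angular eigenvalue `λ`, there is a mass `μ₀` with `μ₀² > ω²` and a
nonzero finite-energy solution of the radial ODE with the correct boundary conditions. -/
theorem stmt9 (M a : ℝ) (hM : 0 < M) (ha : |a| < M) (m : ℤ)
    (ω lam : ℝ) (hω : ω ≠ 0) (hsup : a * m - 2 * M * rPlus M a * ω = 0)
    (hlam : (|m| : ℝ) * (|m| + 1) ≤ lam + a ^ 2 * ω ^ 2) :
    ∃ μ₀ : ℝ, ω ^ 2 < μ₀ ^ 2 ∧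
      ∃ f : ℝ → ℂ,
        (∃ r ∈ Ioi (rPlus M a), f r ≠ 0) ∧
        ContDiffOn ℝ 2 f (Ioi (rPlus M a)) ∧
        RadialODE M a m ω lam μ₀ f ∧
        ContDiffOn ℝ 1 f (Ici (rPlus M a)) ∧
        f (rPlus M a) ≠ 0 ∧
        ExpDecay (rPlus M a) f := by
  have hs2 : 0 < M ^ 2 - a ^ 2 := by
    have := sq_lt_sq' (by linarith [neg_abs_le a, abs_nonneg a]) (lt_of_le_of_lt (le_abs_self a) ha)
    linarith
  have hs := Real.sqrt_pos.2 hs2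
  have hss := Real.sq_sqrt hs2.le
  set rp := rPlus M a with hrp
  set d := rp - rMinus M a with hdd
  have hsq : Real.sqrt (M ^ 2 - a ^ 2) = rp - M := by rw [hrp, rPlus]; ring
  have hrm : rMinus M a = 2 * M - rp := by rw [rMinus, hsq]; ring
  have ha2 : a ^ 2 = 2 * M * rp - rp ^ 2 := by
    rw [hsq] at hss; linarith
  have hdp : 0 < d := by rw [hdd, hrm]; rw [hsq] at hs; linarith
  have hrpp : 0 < rp := by rw [hsq] at hs; linarith
  have hω2 : 0 < ω ^ 2 := by positivity
  obtain ⟨ε, f, g, hε, S, hpos, C, c, hC, hc, hdec⟩ := core (p := rp) (d := d) (A := 2 * M * ω ^ 2)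
    (B := lam) (E := 4 * M ^ 2 * ω ^ 2) hrpp hdp (by positivity) (by positivity)
  have hμ : (Real.sqrt (ω ^ 2 + ε)) ^ 2 = ω ^ 2 + ε := Real.sq_sqrt (by positivity)
  have hDelta : ∀ r, Delta M a r = (r - rp) * ((r - rp) + d) := by
    intro r; rw [Delta, hdd, hrp]; ring
  have hV : ∀ r, rp < r → Vpot M a m ω lam (Real.sqrt (ω ^ 2 + ε)) r
      = (r - rp) * ((r - rp) + d) *
        qf rp d (2 * M * ω ^ 2) lam (4 * M ^ 2 * ω ^ 2) ε (r - rp) := by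
    intro r hr
    have hx : 0 < r - rp := sub_pos.2 hr
    have hxd : r - rp + d ≠ 0 := by positivity
    rw [Vpot, hDelta, hμ, qf, abs_of_pos hx]
    have ham : a * m = 2 * M * rp * ω := by linarith
    have e1 : 4 * M * a * m * r * ω = 4 * M * (a * m) * r * ω := by ring
    have e2 : a ^ 2 * (m:ℝ) ^ 2 = (a * m) ^ 2 := by ring
    have e3 : (r - rp) * (r - rp + d) * (ε * (r - rp + rp) ^ 2 - 2 * M * ω ^ 2 * (r - rp + rp) + lam
        - 4 * M ^ 2 * ω ^ 2 * ((r - rp) / (r - rp + d)))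
        = (r - rp) * (r - rp + d) * (ε * r ^ 2 - 2 * M * ω ^ 2 * r + lam)
        - 4 * M ^ 2 * ω ^ 2 * (r - rp) ^ 2 := by
      field_simp; ring
    rw [e1, e2, ham, ha2, e3, hdd, hrm]
    ring
  set h : ℝ → ℂ := fun r => ((f (r - rp) : ℝ) : ℂ) with hh
  have hfd : ∀ r, HasDerivAt (fun r => f (r - rp)) (g (r - rp)) r := fun r =>
    (S.hf (r - rp)).comp_sub_const r rp
  have hhd : ∀ r, HasDerivAt h ((g (r - rp) : ℝ) : ℂ) r := fun r => (hfd r).ofReal_comp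
  have hderiv : deriv h = fun r => ((g (r - rp) : ℝ) : ℂ) := funext fun r => (hhd r).deriv
  have hP : ∀ r, rp < r → HasDerivAt (fun r => (r - rp) * ((r - rp) + d) * g (r - rp))
      (qf rp d (2 * M * ω ^ 2) lam (4 * M ^ 2 * ω ^ 2) ε (r - rp) * f (r - rp)) r := fun r hr =>
    (S.hP (r - rp) (sub_pos.2 hr)).comp_sub_const r rp
  have hgc : Continuous fun r => g (r - rp) := S.hg.comp (by fun_prop)
  have hfc : Continuous fun r => f (r - rp) := S.cont.comp (by fun_prop)
  have hC1 : ContDiff ℝ 1 h := by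
    rw [contDiff_one_iff_deriv]
    refine ⟨fun r => (hhd r).differentiableAt, ?_⟩
    rw [hderiv]
    exact Complex.continuous_ofReal.comp hgc
  refine ⟨Real.sqrt (ω ^ 2 + ε), by rw [hμ]; linarith, h, ?_, ?_, ?_, hC1.contDiffOn, ?_, ?_⟩
  · refine ⟨rp + 1, by simp, ?_⟩
    have := hpos (rp + 1 - rp) (by simp)
    simp only [hh]
    exact_mod_cast this.ne'
  · have hPc : ContDiffOn ℝ 1 (fun r => (r - rp) * ((r - rp) + d) * g (r - rp)) (Ioi rp) := by
      rw [show (1 : WithTop ℕ∞) = 0 + 1 by simp, contDiffOn_succ_iff_deriv_of_isOpen isOpen_Ioi]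
      refine ⟨fun r hr => (hP r hr).differentiableAt.differentiableWithinAt, by simp, ?_⟩
      rw [contDiffOn_zero]
      refine ContinuousOn.congr ?_ (fun r hr => (hP r hr).deriv)
      apply Continuous.continuousOn
      exact ((qf_cont rp _ lam _ ε hdp).comp (continuous_sub_right rp)).mul hfc
    have hgC : ContDiffOn ℝ 1 (fun r => g (r - rp)) (Ioi rp) := by
      have : ContDiffOn ℝ 1 (fun r => ((r - rp) * ((r - rp) + d) * g (r - rp)) /
          ((r - rp) * ((r - rp) + d))) (Ioi rp) := by
        apply hPc.div
        · apply ContDiff.contDiffOn; fun_prop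
        · intro r hr
          have : 0 < r - rp := sub_pos.2 hr
          positivity
      refine this.congr fun r hr => ?_
      have h0 : 0 < r - rp := sub_pos.2 hr
      have h1 : (r - rp) * ((r - rp) + d) ≠ 0 := by positivity
      rw [mul_div_cancel_left₀ _ h1]
    rw [show (2 : WithTop ℕ∞) = 1 + 1 by norm_num, contDiffOn_succ_iff_deriv_of_isOpen isOpen_Ioi]
    refine ⟨fun r _ => (hhd r).differentiableAt.differentiableWithinAt, by simp, ?_⟩
    rw [hderiv]
    exact Complex.ofRealCLM.contDiff.comp_contDiffOn hgC
  · intro r hr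
    have hr' : rp < r := hr
    rw [hderiv]
    have e : (fun s => (Delta M a s : ℂ) * ((g (s - rp) : ℝ) : ℂ))
        = fun s => (((s - rp) * ((s - rp) + d) * g (s - rp) : ℝ) : ℂ) := by
      funext s
      rw [hDelta]; push_cast; ring
    rw [e, (hP r hr').ofReal_comp.deriv, hV r hr', hDelta, hh]
    push_cast; ring
  · simp only [hh, sub_self, S.f0]; simp
  · refine ⟨C * Real.exp (c * rp), c, by positivity, hc, ?_⟩
    intro r hr
    have := hdec (r - rp) (by linarith)
    rw [hderiv, hh]
    simp only [Complex.norm_real, Real.norm_eq_abs]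
    refine this.trans (le_of_eq ?_)
    rw [mul_assoc, ← Real.exp_add]
    congr 2; ring
end

section
/- Let z₀ ∈ ℂ, r > 0, U ⊂ ℂ open, and let f(z, λ), g(z, λ) be such that (z − z₀)·f(z, λ) = Σ_{j≥0} f_j(λ)·(z − z₀)^j and (z − z₀)²·g(z, λ) = Σ_{j≥0} g_j(λ)·(z − z₀)^j on the punctured disc B_r(z₀) \ {z₀}, where each f_j, g_j is holomorphic on U and, for each compact K ⊂ U, there are nonnegative constants F_j^{(K)}, G_j^{(K)} with |f_j(λ)| ≤ F_j^{(K)} and |g_j(λ)| ≤ G_j^{(K)} for λ ∈ K and Σ_j F_j^{(K)}·s^j, Σ_j G_j^{(K)}·s^j absolutely convergent for 0 ≤ s < r. Set Q(α, λ) := α·(α − 1) + f₀(λ)·α + g₀(λ), and suppose α : U → ℂ is holomorphic with Q(α(λ), λ) = 0 and Q(α(λ) + j, λ) ≠ 0 for every positive integer j and every λ ∈ U. Then there exists a unique function ρ(z, λ), holomorphic in z ∈ B_r(z₀) and in λ ∈ U, with ρ(z₀, λ) = 1, such that H(z) := (z − z₀)^{α(λ)}·ρ(z, λ) (for a fixed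 branch of (z − z₀)^{α(λ)} on a slit disc) solves H'' + f(z, λ)·H' + g(z, λ)·H = 0 on the slit disc minus z₀. -/
open Set Metric Filter Topology

/-- The property of being the normalized Frobenius solution family: `ρ` is holomorphic in
`z` on the disc and in the parameter `λ` on `U`, `ρ(z₀, λ) = 1`, and
`H(z) = (z − z₀)^{α(λ)} ρ(z, λ)` (principal branch) solves `H'' + f H' + g H = 0` on the
slit disc minus `z₀`. -/
def IsFrobeniusFamily (z₀ : ℂ) (r : ℝ) (U : Set ℂ) (f g : ℂ → ℂ → ℂ)
    (α : ℂ → ℂ) (ρ : ℂ → ℂ → ℂ) : Prop :=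
  (∀ lam ∈ U, AnalyticOnNhd ℂ (fun z => ρ z lam) (Metric.ball z₀ r)) ∧
  (∀ z ∈ Metric.ball z₀ r, AnalyticOnNhd ℂ (fun lam => ρ z lam) U) ∧
  (∀ lam ∈ U, ρ z₀ lam = 1) ∧
  (∀ lam ∈ U, ∀ z ∈ Metric.ball z₀ r,
    (¬ ∃ t : ℝ, t ≤ 0 ∧ z - z₀ = (t : ℂ)) →
    deriv (deriv (fun w => (w - z₀) ^ (α lam) * ρ w lam)) z
      + f z lam * deriv (fun w => (w - z₀) ^ (α lam) * ρ w lam) z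
      + g z lam * ((z - z₀) ^ (α lam) * ρ z lam) = 0)

/-- `h` is the sum of the power series with coefficients `a` on the ball. -/
def FrobS (z₀ : ℂ) (r : ℝ) (a : ℕ → ℂ) (h : ℂ → ℂ) : Prop :=
  ∀ z ∈ Metric.ball z₀ r, HasSum (fun n => a n * (z - z₀) ^ n) (h z)

lemma FrobS.norm_summable {z₀ : ℂ} {r : ℝ} {a : ℕ → ℂ} {h : ℂ → ℂ} (H : FrobS z₀ r a h)
    {s : ℝ} (hs : 0 ≤ s) (hsr : s < r) : Summable (fun n => ‖a n‖ * s ^ n) := by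
  have h1 := (H (z₀ + s) (by simp [abs_of_nonneg hs, hsr])).summable.norm
  simpa [abs_of_nonneg hs] using h1

lemma FrobS.add {z₀ : ℂ} {r : ℝ} {a b : ℕ → ℂ} {h k : ℂ → ℂ} (H : FrobS z₀ r a h)
    (K : FrobS z₀ r b k) : FrobS z₀ r (fun n => a n + b n) (fun z => h z + k z) := by
  intro z hz
  simpa [add_mul] using (H z hz).add (K z hz)

lemma FrobS.smul {z₀ : ℂ} {r : ℝ} {a : ℕ → ℂ} {h : ℂ → ℂ} (c : ℂ) (H : FrobS z₀ r a h) :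
    FrobS z₀ r (fun n => c * a n) (fun z => c * h z) := by
  intro z hz
  simpa [mul_assoc] using (H z hz).mul_left c

lemma FrobS.mul {z₀ : ℂ} {r : ℝ} {a b : ℕ → ℂ} {h k : ℂ → ℂ} (H : FrobS z₀ r a h)
    (K : FrobS z₀ r b k) :
    FrobS z₀ r (fun n => ∑ j ∈ Finset.range (n + 1), a j * b (n - j)) (fun z => h z * k z) := by
  intro z hz
  have := hasSum_sum_range_mul_of_summable_norm (H z hz).summable.norm (K z hz).summable.norm
  rw [(H z hz).tsum_eq, (K z hz).tsum_eq] at this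
  convert! this using 2 with n
  rw [Finset.sum_mul]
  refine Finset.sum_congr rfl fun j hj => ?_
  have hj' : j ≤ n := by simpa [Nat.lt_succ_iff] using hj
  obtain ⟨m, rfl⟩ := Nat.exists_eq_add_of_le hj'
  simp [pow_add]; ring

lemma FrobS.termwise {z₀ : ℂ} {r : ℝ} {a : ℕ → ℂ} {h : ℂ → ℂ} (H : FrobS z₀ r a h)
    {z : ℂ} (hz : z ∈ Metric.ball z₀ r) :
    DifferentiableAt ℂ h z ∧ HasSum (fun n => deriv (fun w => a n * (w - z₀) ^ n) z) (deriv h z) := by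
  obtain ⟨s, h1, h2⟩ := exists_between (Metric.mem_ball.mp hz)
  have hs : 0 ≤ s := dist_nonneg.trans h1.le
  have hsum := H.norm_summable hs h2
  have hd : ∀ n : ℕ, DifferentiableOn ℂ (fun w => a n * (w - z₀) ^ n) (Metric.ball z₀ s) := by
    intro n; fun_prop
  have hle : ∀ (n : ℕ) (w : ℂ), w ∈ Metric.ball z₀ s → ‖a n * (w - z₀) ^ n‖ ≤ ‖a n‖ * s ^ n := by
    intro n w hw
    rw [norm_mul, norm_pow]
    have : ‖w - z₀‖ ≤ s := (by simpa [dist_eq_norm] using hw : ‖w - z₀‖ < s).le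
    gcongr
  have hzs : z ∈ Metric.ball z₀ s := h1
  have heq : (fun w => ∑' n, a n * (w - z₀) ^ n) =ᶠ[𝓝 z] h := by
    filter_upwards [Metric.isOpen_ball.mem_nhds hz] with w hw
    exact (H w hw).tsum_eq
  constructor
  · have := (Complex.differentiableOn_tsum_of_summable_norm hsum hd Metric.isOpen_ball hle).differentiableAt
      (Metric.isOpen_ball.mem_nhds hzs)
    exact this.congr_of_eventuallyEq heq.symm
  · have := Complex.hasSum_deriv_of_summable_norm hsum hd Metric.isOpen_ball hle hzs
    rwa [heq.deriv_eq] at this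

lemma FrobS.theta {z₀ : ℂ} {r : ℝ} {a : ℕ → ℂ} {h : ℂ → ℂ} (H : FrobS z₀ r a h) :
    FrobS z₀ r (fun n => n * a n) (fun z => (z - z₀) * deriv h z) := by
  intro z hz
  have := (H.termwise hz).2.mul_left (z - z₀)
  convert! this using 2 with n
  have hd : HasDerivAt (fun w => a n * (w - z₀) ^ n) (a n * (n * (z - z₀) ^ (n - 1) * 1)) z :=
    (((hasDerivAt_id z).sub_const z₀).pow n).const_mul _
  rw [hd.deriv]
  rcases n with _ | n
  · simp
  · simp [pow_succ]; ring

lemma FrobS.analytic {z₀ : ℂ} {r : ℝ} {a : ℕ → ℂ} {h : ℂ → ℂ} (H : FrobS z₀ r a h) :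
    AnalyticOnNhd ℂ h (Metric.ball z₀ r) := by
  apply DifferentiableOn.analyticOnNhd _ Metric.isOpen_ball
  intro z hz
  exact (H.termwise hz).1.differentiableWithinAt

lemma FrobS.eq_zero {z₀ : ℂ} {r : ℝ} (hr : 0 < r) {a : ℕ → ℂ} {h : ℂ → ℂ} (H : FrobS z₀ r a h)
    (hz : ∃ᶠ z in 𝓝[≠] z₀, h z = 0) (n : ℕ) : a n = 0 := by
  have h0 := (H.analytic z₀ (Metric.mem_ball_self hr)).frequently_zero_iff_eventually_zero.mp hz
  have hp : HasFPowerSeriesAt h (FormalMultilinearSeries.ofScalars ℂ a) z₀ := by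
    rw [hasFPowerSeriesAt_iff]
    filter_upwards [Metric.ball_mem_nhds (0 : ℂ) hr] with w hw
    have := H (z₀ + w) (by simpa using hw)
    simpa [FormalMultilinearSeries.coeff_ofScalars, mul_comm] using this
  have := (hp.congr h0).eq_zero
  have h2 : (FormalMultilinearSeries.ofScalars ℂ a).coeff n = 0 := by rw [this]; rfl
  simpa [FormalMultilinearSeries.coeff_ofScalars] using h2

lemma FrobS.of_analytic {z₀ : ℂ} {r : ℝ} {h : ℂ → ℂ}
    (H : AnalyticOnNhd ℂ h (Metric.ball z₀ r)) : ∃ a, FrobS z₀ r a h := by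
  refine ⟨fun n => (n.factorial : ℂ)⁻¹ * iteratedDeriv n h z₀, fun z hz => ?_⟩
  convert! Complex.hasSum_taylorSeries_on_ball H.differentiableOn hz using 2 with n
  simp only [smul_eq_mul]; ring

/-- Coefficients of the operator applied to a series. -/
lemma FrobS.oper {z₀ : ℂ} {r : ℝ} {c φ γ : ℕ → ℂ} {h F G : ℂ → ℂ} (a : ℂ) (H : FrobS z₀ r c h)
    (hF : FrobS z₀ r φ F) (hG : FrobS z₀ r γ G) :
    FrobS z₀ r (fun n => ((a + n) * (a + n - 1) + φ 0 * (a + n) + γ 0) * c n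
        + ∑ k ∈ Finset.range n, ((k + a) * φ (n - k) + γ (n - k)) * c k)
      (fun z => (z - z₀) ^ 2 * deriv (deriv h) z + 2 * a * ((z - z₀) * deriv h z)
        + a * (a - 1) * h z + F z * ((z - z₀) * deriv h z + a * h z) + G z * h z) := by
  have T := H.theta
  have T2 := T.theta
  have L := ((((T2.add (T.smul (2 * a - 1))).add (H.smul (a * (a - 1)))).add
    ((T.add (H.smul a)).mul hF))).add (H.mul hG)
  intro z hz
  have hdd : DifferentiableAt ℂ (deriv h) z := (H.analytic z hz).deriv.differentiableAt
  have e : deriv (fun z => (z - z₀) * deriv h z) z = deriv h z + (z - z₀) * deriv (deriv h) z := by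
    have := (((hasDerivAt_id z).sub_const z₀).mul hdd.hasDerivAt).deriv
    simp only [id, one_mul] at this
    exact this
  convert! L z hz using 1
  · funext n
    congr 1
    beta_reduce
    rw [Finset.sum_range_succ, Finset.sum_range_succ]
    simp only [add_mul, Finset.sum_add_distrib, Nat.sub_self]
    have : ∑ k ∈ Finset.range n, ((k : ℂ) * φ (n - k) * c k) = ∑ k ∈ Finset.range n, ((k : ℂ) * c k * φ (n - k)) :=
      Finset.sum_congr rfl fun _ _ => by ring
    rw [this]
    have : ∑ k ∈ Finset.range n, (a * φ (n - k) * c k) = ∑ k ∈ Finset.range n, (a * c k * φ (n - k)) :=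
      Finset.sum_congr rfl fun _ _ => by ring
    rw [this]
    have : ∑ k ∈ Finset.range n, (γ (n - k) * c k) = ∑ k ∈ Finset.range n, (c k * γ (n - k)) :=
      Finset.sum_congr rfl fun _ _ => by ring
    rw [this]
    ring
  · beta_reduce
    rw [e]; ring

/-- The ODE operator in terms of `ρ`. -/
lemma frob_ode {z₀ : ℂ} {r : ℝ} {h : ℂ → ℂ} (a : ℂ) (H : AnalyticOnNhd ℂ h (Metric.ball z₀ r))
    {z : ℂ} (hz : z ∈ Metric.ball z₀ r) (hs : z - z₀ ∈ Complex.slitPlane) (f g : ℂ) :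
    (z - z₀) ^ 2 * (deriv (deriv (fun w => (w - z₀) ^ a * h w)) z
      + f * deriv (fun w => (w - z₀) ^ a * h w) z
      + g * ((z - z₀) ^ a * h z)) =
    (z - z₀) ^ a * ((z - z₀) ^ 2 * deriv (deriv h) z + 2 * a * ((z - z₀) * deriv h z)
        + a * (a - 1) * h z + ((z - z₀) * f) * ((z - z₀) * deriv h z + a * h z)
        + ((z - z₀) ^ 2 * g) * h z) := by
  have key : ∀ b : ℂ, ∀ w, w - z₀ ∈ Complex.slitPlane →
      HasDerivAt (fun w => (w - z₀) ^ b) (b * (w - z₀) ^ (b - 1)) w := by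
    intro b w hw
    simpa using ((hasDerivAt_id w).sub_const z₀).cpow_const (c := b) hw
  have d1 : ∀ w ∈ Metric.ball z₀ r, w - z₀ ∈ Complex.slitPlane →
      HasDerivAt (fun w => (w - z₀) ^ a * h w)
        (a * (w - z₀) ^ (a - 1) * h w + (w - z₀) ^ a * deriv h w) w := fun w hw hw' =>
    (key a w hw').mul (H w hw).differentiableAt.hasDerivAt
  have hopen : ∀ᶠ w in 𝓝 z, w - z₀ ∈ Complex.slitPlane :=
    (continuous_id.sub continuous_const).continuousAt.eventually_mem
      (Complex.isOpen_slitPlane.mem_nhds hs)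
  have ev : deriv (fun w => (w - z₀) ^ a * h w) =ᶠ[𝓝 z]
      fun w => a * (w - z₀) ^ (a - 1) * h w + (w - z₀) ^ a * deriv h w := by
    filter_upwards [Metric.isOpen_ball.mem_nhds hz, hopen] with w hw hw'
    exact (d1 w hw hw').deriv
  have d2 := ((((key (a - 1) z hs).const_mul a).mul (H z hz).differentiableAt.hasDerivAt).add
    ((key a z hs).mul (H z hz).deriv.differentiableAt.hasDerivAt))
  have d2' : deriv (deriv (fun w => (w - z₀) ^ a * h w)) z = _ := ev.deriv_eq.trans d2.deriv
  rw [d2', (d1 z hz hs).deriv]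
  have hne : z - z₀ ≠ 0 := Complex.slitPlane_ne_zero hs
  rw [Complex.cpow_sub _ _ hne, Complex.cpow_sub _ _ hne, Complex.cpow_one]
  field_simp
  ring

/-- The Frobenius coefficients. -/
noncomputable def frobC (φ γ : ℕ → ℂ) (a : ℂ) : ℕ → ℂ
  | 0 => 1
  | n + 1 => -(∑ k : Fin (n + 1), ((k.1 + a) * φ (n + 1 - k.1) + γ (n + 1 - k.1)) * frobC φ γ a k.1)
      / ((a + (n + 1 : ℕ)) * (a + (n + 1 : ℕ) - 1) + φ 0 * (a + (n + 1 : ℕ)) + γ 0)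
  decreasing_by exact k.2

lemma frobC_zero (φ γ : ℕ → ℂ) (a : ℂ) : frobC φ γ a 0 = 1 := by rw [frobC]

lemma frobC_pos (φ γ : ℕ → ℂ) (a : ℂ) (n : ℕ) (hn : 0 < n) :
    frobC φ γ a n = -(∑ k ∈ Finset.range n, ((k + a) * φ (n - k) + γ (n - k)) * frobC φ γ a k)
      / ((a + n) * (a + n - 1) + φ 0 * (a + n) + γ 0) := by
  obtain ⟨m, rfl⟩ := Nat.exists_eq_succ_of_ne_zero hn.ne'
  rw [Nat.succ_eq_add_one, frobC, Finset.sum_range]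

lemma frobC_bound (F G : ℕ → ℝ) (hF0 : ∀ j, 0 ≤ F j) (hG0 : ∀ j, 0 ≤ G j) (s A B : ℝ) (hs : 0 ≤ s)
    (hA : 0 ≤ A) (hF : Summable (fun j => F j * s ^ j)) (hG : Summable (fun j => G j * s ^ j)) :
    ∃ N : ℕ, ∀ (φ γ : ℕ → ℂ) (a : ℂ) (C : ℝ), (∀ j, ‖φ j‖ ≤ F j) → (∀ j, ‖γ j‖ ≤ G j) → ‖a‖ ≤ A →
      ‖2 * a - 1 + φ 0‖ ≤ B → a * (a - 1) + φ 0 * a + γ 0 = 0 →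
      (∀ j ≤ N, ‖frobC φ γ a j‖ * s ^ j ≤ C) → ∀ n, ‖frobC φ γ a n‖ * s ^ n ≤ C := by
  set S := ∑' j, F j * s ^ j + ∑' j, G j * s ^ j with hS
  have hSF : 0 ≤ ∑' j, F j * s ^ j := tsum_nonneg fun j => mul_nonneg (hF0 j) (by positivity)
  have hSG : 0 ≤ ∑' j, G j * s ^ j := tsum_nonneg fun j => mul_nonneg (hG0 j) (by positivity)
  have hS0 : 0 ≤ S := by positivity
  obtain ⟨N, hN⟩ := exists_nat_ge (B + S * (A + 2))
  refine ⟨N, fun φ γ a C hφ hγ ha hB hind hC n => ?_⟩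
  have hC0 : 0 ≤ C := le_trans (by positivity) (hC 0 (Nat.zero_le _))
  induction n using Nat.strong_induction_on with
  | _ n ih =>
  rcases le_or_gt n N with h | h
  · exact hC n h
  have hn : 0 < n := by omega
  have hn1 : (1 : ℝ) ≤ n := by exact_mod_cast hn
  have hnN : (N : ℝ) < n := by exact_mod_cast h
  rw [frobC_pos _ _ _ _ hn]
  have hQ : (a + n) * (a + n - 1) + φ 0 * (a + n) + γ 0 = n * (n + (2 * a - 1 + φ 0)) := by
    linear_combination hind
  rw [hQ, norm_div, norm_neg, norm_mul, div_mul_eq_mul_div]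
  have hlow : (n : ℝ) - B ≤ ‖(n : ℂ) + (2 * a - 1 + φ 0)‖ := by
    have := norm_sub_norm_le (n : ℂ) (-(2 * a - 1 + φ 0))
    rw [norm_neg, sub_neg_eq_add, Complex.norm_natCast] at this
    linarith
  have hSA : 0 ≤ S * (A + 2) := by positivity
  have hpos : 0 < (n : ℝ) - B := by linarith
  rw [Complex.norm_natCast, div_le_iff₀ (by
    apply mul_pos; linarith; linarith)]
  have hnum : ‖∑ k ∈ Finset.range n, ((k + a) * φ (n - k) + γ (n - k)) * frobC φ γ a k‖ * s ^ n
      ≤ C * ((n + A + 1) * S) := by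
    have sumle : ∀ E : ℕ → ℝ, (∀ j, 0 ≤ E j) → Summable (fun j => E j * s ^ j) →
        ∑ k ∈ Finset.range n, E (n - k) * s ^ (n - k) ≤ ∑' j, E j * s ^ j := by
      intro E hE hsum
      have h1 : ∑ k ∈ Finset.range n, E (n - k) * s ^ (n - k)
          ≤ ∑ k ∈ Finset.range (n + 1), E (n - k) * s ^ (n - k) := by
        rw [Finset.sum_range_succ]
        have := hE (n - n)
        have : 0 ≤ E (n - n) * s ^ (n - n) := by positivity
        linarith
      have h2 := Finset.sum_range_reflect (fun j => E j * s ^ j) (n + 1)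
      simp only [Nat.add_sub_cancel] at h2
      rw [h2] at h1
      exact h1.trans (hsum.sum_le_tsum _ fun j _ => mul_nonneg (hE j) (by positivity))
    calc _ ≤ (∑ k ∈ Finset.range n, ‖((k + a) * φ (n - k) + γ (n - k)) * frobC φ γ a k‖) * s ^ n := by
          gcongr; exact norm_sum_le _ _
      _ = ∑ k ∈ Finset.range n, ‖((k + a) * φ (n - k) + γ (n - k)) * frobC φ γ a k‖ * s ^ n :=
          Finset.sum_mul _ _ _
      _ ≤ ∑ k ∈ Finset.range n, (C * (n + A + 1)) * (F (n - k) * s ^ (n - k) + G (n - k) * s ^ (n - k)) := by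
          apply Finset.sum_le_sum
          intro k hk
          have hk' : k < n := Finset.mem_range.mp hk
          have hkr : (k : ℝ) ≤ n := by exact_mod_cast hk'.le
          have hb : ‖(k + a) * φ (n - k) + γ (n - k)‖ ≤ (n + A + 1) * (F (n - k) + G (n - k)) := by
            have e1 : ‖(k : ℂ) + a‖ ≤ n + A := by
              refine (norm_add_le _ _).trans ?_
              rw [Complex.norm_natCast]; linarith
            have e2 : ‖((k : ℂ) + a) * φ (n - k)‖ ≤ (n + A) * F (n - k) := by
              rw [norm_mul]
              exact mul_le_mul e1 (hφ _) (norm_nonneg _) (by positivity)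
            have e3 := norm_add_le (((k : ℂ) + a) * φ (n - k)) (γ (n - k))
            have e4 := hγ (n - k)
            have e5 := hF0 (n - k)
            have e6 : 0 ≤ (n + A) * G (n - k) := mul_nonneg (by positivity) (hG0 _)
            linarith
          have hp : s ^ n = s ^ k * s ^ (n - k) := by rw [← pow_add]; congr 1; omega
          rw [norm_mul, hp]
          calc _ = ‖(k + a) * φ (n - k) + γ (n - k)‖ * (‖frobC φ γ a k‖ * s ^ k) * s ^ (n - k) := by ring
            _ ≤ ((n + A + 1) * (F (n - k) + G (n - k))) * C * s ^ (n - k) := by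
                have := ih k hk'
                have := hF0 (n - k)
                have := hG0 (n - k)
                gcongr
            _ = _ := by ring
      _ = (C * (n + A + 1)) * (∑ k ∈ Finset.range n, F (n - k) * s ^ (n - k) + ∑ k ∈ Finset.range n, G (n - k) * s ^ (n - k)) := by
          rw [← Finset.mul_sum, Finset.sum_add_distrib]
      _ ≤ (C * (n + A + 1)) * S := by
          have := sumle F hF0 hF
          have := sumle G hG0 hG
          rw [hS]
          gcongr
      _ = _ := by ring
  refine hnum.trans ?_
  apply mul_le_mul_of_nonneg_left _ hC0
  have e1 : (n : ℝ) + A + 1 ≤ n * (A + 2) := by nlinarith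
  have e2 : S * (A + 2) ≤ n - B := by linarith
  calc (n + A + 1) * S ≤ n * (A + 2) * S := by gcongr
    _ = n * (S * (A + 2)) := by ring
    _ ≤ n * ‖(n : ℂ) + (2 * a - 1 + φ 0)‖ := by
      gcongr; linarith

lemma frobC_analytic {U : Set ℂ} (fc gc : ℕ → ℂ → ℂ) (hfc : ∀ j : ℕ, AnalyticOnNhd ℂ (fc j) U)
    (hgc : ∀ j : ℕ, AnalyticOnNhd ℂ (gc j) U) (α : ℂ → ℂ) (hα : AnalyticOnNhd ℂ α U)
    (hnonres : ∀ lam ∈ U, ∀ j : ℕ, 0 < j →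
      (α lam + j) * (α lam + j - 1) + fc 0 lam * (α lam + j) + gc 0 lam ≠ 0) (n : ℕ) :
    AnalyticOnNhd ℂ (fun lam => frobC (fun j => fc j lam) (fun j => gc j lam) (α lam) n) U := by
  induction n using Nat.strong_induction_on with
  | _ n ih =>
  rcases Nat.eq_zero_or_pos n with rfl | hn
  · simp only [frobC_zero]
    exact analyticOnNhd_const
  · simp_rw [frobC_pos _ _ _ _ hn]
    intro lam hlam
    have ha := hα lam hlam
    have h0 := hfc 0 lam hlam
    have g0 := hgc 0 lam hlam
    refine AnalyticAt.fun_div (AnalyticAt.fun_neg (Finset.analyticAt_fun_sum _ fun k hk => ?_)) ?_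
      (hnonres lam hlam n hn)
    · have h1 := ih k (Finset.mem_range.mp hk) lam hlam
      have h2 := hfc (n - k) lam hlam
      have h3 := hgc (n - k) lam hlam
      fun_prop
    · fun_prop

lemma frobC_compact {r : ℝ} {U : Set ℂ} (fc gc : ℕ → ℂ → ℂ)
    (hfc : ∀ j : ℕ, AnalyticOnNhd ℂ (fc j) U)
    (hgc : ∀ j : ℕ, AnalyticOnNhd ℂ (gc j) U)
    (hbound : ∀ K : Set ℂ, K ⊆ U → IsCompact K →
      ∃ F G : ℕ → ℝ,
        (∀ j : ℕ, 0 ≤ F j ∧ 0 ≤ G j) ∧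
        (∀ j : ℕ, ∀ lam ∈ K, ‖fc j lam‖ ≤ F j ∧ ‖gc j lam‖ ≤ G j) ∧
        (∀ s : ℝ, 0 ≤ s → s < r →
          Summable (fun j : ℕ => F j * s ^ j) ∧ Summable (fun j : ℕ => G j * s ^ j)))
    (α : ℂ → ℂ) (hα : AnalyticOnNhd ℂ α U)
    (hind : ∀ lam ∈ U, α lam * (α lam - 1) + fc 0 lam * α lam + gc 0 lam = 0)
    (hnonres : ∀ lam ∈ U, ∀ j : ℕ, 0 < j →
      (α lam + j) * (α lam + j - 1) + fc 0 lam * (α lam + j) + gc 0 lam ≠ 0)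
    (K : Set ℂ) (hKU : K ⊆ U) (hK : IsCompact K) (s : ℝ) (hs : 0 ≤ s) (hsr : s < r) :
    ∃ C : ℝ, ∀ lam ∈ K, ∀ n,
      ‖frobC (fun j => fc j lam) (fun j => gc j lam) (α lam) n‖ * s ^ n ≤ C := by
  obtain ⟨F, G, h0, hb, hsum⟩ := hbound K hKU hK
  obtain ⟨A, hA⟩ := hK.exists_bound_of_continuousOn (hα.continuousOn.mono hKU)
  obtain ⟨B, hB⟩ := hK.exists_bound_of_continuousOn (f := fun lam => 2 * α lam - 1 + fc 0 lam)
    (((continuousOn_const.mul (hα.continuousOn.mono hKU)).sub continuousOn_const).add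
      ((hfc 0).continuousOn.mono hKU))
  obtain ⟨N, hN⟩ := frobC_bound F G (fun j => (h0 j).1) (fun j => (h0 j).2) s (max A 0) B hs
    (le_max_right _ _) (hsum s hs hsr).1 (hsum s hs hsr).2
  have hc : ∀ n, ∃ C, ∀ lam ∈ K, ‖frobC (fun j => fc j lam) (fun j => gc j lam) (α lam) n‖ ≤ C :=
    fun n => hK.exists_bound_of_continuousOn
      ((frobC_analytic fc gc hfc hgc α hα hnonres n).continuousOn.mono hKU)
  choose c hc using hc
  refine ⟨∑ j ∈ Finset.range (N + 1), |c j| * s ^ j, fun lam hlam => ?_⟩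
  apply hN _ _ _ _ (fun j => (hb j lam hlam).1) (fun j => (hb j lam hlam).2)
    ((hA lam hlam).trans (le_max_left _ _)) (hB lam hlam) (hind lam (hKU hlam))
  intro j hj
  have h1 : ‖frobC (fun j => fc j lam) (fun j => gc j lam) (α lam) j‖ * s ^ j ≤ |c j| * s ^ j := by
    gcongr
    exact (hc j lam hlam).trans (le_abs_self _)
  exact h1.trans (Finset.single_le_sum (f := fun j => |c j| * s ^ j) (fun i _ => by positivity)
    (Finset.mem_range.mpr (by omega)))

lemma frob_geom (c : ℂ) (w : ℂ) (s C : ℝ) (n : ℕ) (hs : 0 < s) (h : ‖c‖ * s ^ n ≤ C) :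
    ‖c * w ^ n‖ ≤ C * (‖w‖ / s) ^ n := by
  rw [norm_mul, norm_pow, div_pow, mul_div_assoc', le_div_iff₀ (by positivity)]
  calc _ = (‖c‖ * s ^ n) * ‖w‖ ^ n := by ring
    _ ≤ _ := by gcongr

/-- Frobenius theory at a regular singular point with holomorphic parameter
dependence: existence and uniqueness of the normalized solution `(z − z₀)^{α(λ)} ρ(z, λ)`
with `ρ(z₀, λ) = 1`, holomorphic in both variables. -/
theorem stmt18 (z₀ : ℂ) (r : ℝ) (hr : 0 < r) (U : Set ℂ) (hU : IsOpen U)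
    (f g : ℂ → ℂ → ℂ) (fc gc : ℕ → ℂ → ℂ)
    (hfc : ∀ j : ℕ, AnalyticOnNhd ℂ (fc j) U)
    (hgc : ∀ j : ℕ, AnalyticOnNhd ℂ (gc j) U)
    (hbound : ∀ K : Set ℂ, K ⊆ U → IsCompact K →
      ∃ F G : ℕ → ℝ,
        (∀ j : ℕ, 0 ≤ F j ∧ 0 ≤ G j) ∧
        (∀ j : ℕ, ∀ lam ∈ K, ‖fc j lam‖ ≤ F j ∧ ‖gc j lam‖ ≤ G j) ∧
        (∀ s : ℝ, 0 ≤ s → s < r →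
          Summable (fun j : ℕ => F j * s ^ j) ∧ Summable (fun j : ℕ => G j * s ^ j)))
    (hf : ∀ lam ∈ U, ∀ z ∈ Metric.ball z₀ r \ {z₀},
      (z - z₀) * f z lam = ∑' j : ℕ, fc j lam * (z - z₀) ^ j)
    (hg : ∀ lam ∈ U, ∀ z ∈ Metric.ball z₀ r \ {z₀},
      (z - z₀) ^ 2 * g z lam = ∑' j : ℕ, gc j lam * (z - z₀) ^ j)
    (α : ℂ → ℂ) (hα : AnalyticOnNhd ℂ α U)
    (hind : ∀ lam ∈ U, α lam * (α lam - 1) + fc 0 lam * α lam + gc 0 lam = 0)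
    (hnonres : ∀ lam ∈ U, ∀ j : ℕ, 0 < j →
      (α lam + j) * (α lam + j - 1) + fc 0 lam * (α lam + j) + gc 0 lam ≠ 0) :
    ∃ ρ : ℂ → ℂ → ℂ, IsFrobeniusFamily z₀ r U f g α ρ ∧
      ∀ ρ' : ℂ → ℂ → ℂ, IsFrobeniusFamily z₀ r U f g α ρ' →
        ∀ lam ∈ U, ∀ z ∈ Metric.ball z₀ r, ρ' z lam = ρ z lam := by
  set c : ℂ → ℕ → ℂ := fun lam => frobC (fun j => fc j lam) (fun j => gc j lam) (α lam) with hc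
  have hcomp := frobC_compact fc gc hfc hgc hbound α hα hind hnonres
  have hcan := frobC_analytic fc gc hfc hgc α hα hnonres
  -- the solution series
  have hS : ∀ lam ∈ U, FrobS z₀ r (c lam) (fun z => ∑' n, c lam n * (z - z₀) ^ n) := by
    intro lam hlam z hz
    obtain ⟨s, h1, h2⟩ := exists_between (mem_ball_iff_norm.mp hz)
    have hs : 0 < s := (norm_nonneg _).trans_lt h1
    obtain ⟨C, hC⟩ := hcomp {lam} (by simpa using hlam) isCompact_singleton s hs.le h2
    apply Summable.hasSum
    refine Summable.of_norm_bounded (g := fun n => C * (‖z - z₀‖ / s) ^ n) ?_ fun n =>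
      frob_geom _ _ _ _ _ hs (hC lam rfl n)
    exact (summable_geometric_of_lt_one (by positivity) ((div_lt_one hs).mpr h1)).mul_left C
  -- coefficient series
  have hFG : ∀ lam ∈ U, FrobS z₀ r (fun j => fc j lam) (fun z => ∑' j, fc j lam * (z - z₀) ^ j) ∧
      FrobS z₀ r (fun j => gc j lam) (fun z => ∑' j, gc j lam * (z - z₀) ^ j) := by
    intro lam hlam
    obtain ⟨F, G, h0, hb, hsum⟩ := hbound {lam} (by simpa using hlam) isCompact_singleton
    refine ⟨fun z hz => ?_, fun z hz => ?_⟩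
    · apply Summable.hasSum
      refine Summable.of_norm_bounded (hsum _ (norm_nonneg _) (mem_ball_iff_norm.mp hz)).1 fun n => ?_
      rw [norm_mul, norm_pow]
      gcongr
      exact (hb n lam rfl).1
    · apply Summable.hasSum
      refine Summable.of_norm_bounded (hsum _ (norm_nonneg _) (mem_ball_iff_norm.mp hz)).2 fun n => ?_
      rw [norm_mul, norm_pow]
      gcongr
      exact (hb n lam rfl).2
  refine ⟨fun z lam => ∑' n, c lam n * (z - z₀) ^ n, ⟨?_, ?_, ?_, ?_⟩, ?_⟩
  · exact fun lam hlam => (hS lam hlam).analytic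
  · intro z hz lam hlam
    obtain ⟨s, h1, h2⟩ := exists_between (mem_ball_iff_norm.mp hz)
    have hs : 0 < s := (norm_nonneg _).trans_lt h1
    obtain ⟨ε, hε, hεU⟩ := Metric.nhds_basis_closedBall.mem_iff.mp (hU.mem_nhds hlam)
    obtain ⟨C, hC⟩ := hcomp _ hεU (isCompact_closedBall lam ε) s hs.le h2
    have hsum : Summable (fun n => C * (‖z - z₀‖ / s) ^ n) :=
      (summable_geometric_of_lt_one (by positivity) ((div_lt_one hs).mpr h1)).mul_left C
    have hd := Complex.differentiableOn_tsum_of_summable_norm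
      (F := fun n lam => c lam n * (z - z₀) ^ n) (U := Metric.ball lam ε) hsum
      (fun n => ((hcan n).differentiableOn.mono
        (Metric.ball_subset_closedBall.trans hεU)).mul_const _) Metric.isOpen_ball
      (fun n w hw => frob_geom _ _ _ _ _ hs (hC w (Metric.ball_subset_closedBall hw) n))
    exact hd.analyticOnNhd Metric.isOpen_ball lam (Metric.mem_ball_self hε)
  · intro lam hlam
    have : ∑' n, c lam n * (z₀ - z₀) ^ n = c lam 0 := by
      rw [tsum_eq_single 0]
      · simp
      · intro n hn; simp [hn]
    beta_reduce
    rw [this]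
    exact frobC_zero _ _ _
  · intro lam hlam z hz hslit
    have hslit' : z - z₀ ∈ Complex.slitPlane := by
      rw [Complex.mem_slitPlane_iff_not_le_zero]
      intro hle
      rw [Complex.le_def] at hle
      exact hslit ⟨(z - z₀).re, hle.1, Complex.ext rfl (by simpa using hle.2)⟩
    have hne : z - z₀ ≠ 0 := Complex.slitPlane_ne_zero hslit'
    have hz' : z ∈ Metric.ball z₀ r \ {z₀} := ⟨hz, fun h => hne (by simpa [sub_eq_zero] using h)⟩
    have e := frob_ode (α lam) (hS lam hlam).analytic hz hslit' (f z lam) (g z lam)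
    have o := (hS lam hlam).oper (α lam) (hFG lam hlam).1 (hFG lam hlam).2 z hz
    have hzero : (fun n : ℕ => (((α lam + n) * (α lam + n - 1) + fc 0 lam * (α lam + n) + gc 0 lam) * c lam n
        + ∑ k ∈ Finset.range n, ((k + α lam) * fc (n - k) lam + gc (n - k) lam) * c lam k)
          * (z - z₀) ^ n) = fun _ => 0 := by
      funext n
      rw [mul_eq_zero]; left
      rcases Nat.eq_zero_or_pos n with rfl | hn
      · simp [hind lam hlam]
      · have hq := hnonres lam hlam n hn
        have := frobC_pos (fun j => fc j lam) (fun j => gc j lam) (α lam) n hn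
        rw [eq_div_iff hq] at this
        simp only [hc]
        rw [mul_comm, this]
        ring
    beta_reduce at o
    rw [hzero] at o
    have o' := o.unique hasSum_zero
    rw [← hf lam hlam z hz', ← hg lam hlam z hz'] at o'
    rw [o', mul_zero] at e
    exact (mul_eq_zero.mp e).resolve_left (pow_ne_zero 2 hne)
  · intro ρ' ⟨hρ1, _, hρ3, hρ4⟩ lam hlam z hz
    obtain ⟨b, hb⟩ := FrobS.of_analytic (hρ1 lam hlam)
    have o := hb.oper (α lam) (hFG lam hlam).1 (hFG lam hlam).2
    have hfreq : ∃ᶠ t : ℝ in 𝓝[>] 0, t ∈ Ioo (0 : ℝ) r :=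
      Filter.Eventually.frequently (Ioo_mem_nhdsGT hr)
    have htend : Tendsto (fun t : ℝ => z₀ + (t : ℂ)) (𝓝[>] 0) (𝓝[≠] z₀) := by
      apply tendsto_nhdsWithin_of_tendsto_nhds_of_eventually_within
      · have : ContinuousAt (fun t : ℝ => z₀ + (t : ℂ)) 0 := by fun_prop
        have h2 := this.tendsto
        simp only [Complex.ofReal_zero, add_zero] at h2
        exact h2.mono_left nhdsWithin_le_nhds
      · filter_upwards [self_mem_nhdsWithin] with t ht
        have : t ≠ 0 := ne_of_gt ht
        simpa using this
    have hz0 := o.eq_zero hr (htend.frequently (hfreq.mono (by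
      intro t ht
      have hball : z₀ + (t : ℂ) ∈ Metric.ball z₀ r := by
        simpa [abs_of_pos ht.1] using ht.2
      have hne : z₀ + (t : ℂ) - z₀ ≠ 0 := by simpa using ht.1.ne'
      have hz' : z₀ + (t : ℂ) ∈ Metric.ball z₀ r \ {z₀} := ⟨hball, by simpa using ht.1.ne'⟩
      have hsl : z₀ + (t : ℂ) - z₀ ∈ Complex.slitPlane := by
        rw [add_sub_cancel_left]; exact Complex.ofReal_mem_slitPlane.mpr ht.1
      have e := frob_ode (α lam) (hρ1 lam hlam) hball hsl (f (z₀ + t) lam) (g (z₀ + t) lam)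
      rw [hρ4 lam hlam _ hball (by
        rintro ⟨u, hu, hu'⟩
        rw [add_sub_cancel_left] at hu'
        have : t = u := by exact_mod_cast hu'
        linarith [ht.1]), mul_zero, hf lam hlam _ hz', hg lam hlam _ hz'] at e
      exact (mul_eq_zero.mp e.symm).resolve_left (by simp [Complex.cpow_eq_zero_iff, ht.1.ne']))))
    have hb0 : b 0 = 1 := by
      have h1 := hb z₀ (Metric.mem_ball_self hr)
      have h2 := hasSum_single (f := fun n => b n * (z₀ - z₀) ^ n) 0 (by intro n hn; simp [hn])
      have h3 := h1.unique h2
      beta_reduce at h3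
      rw [hρ3 lam hlam] at h3
      simpa using h3.symm
    have hbc : ∀ n, b n = c lam n := by
      intro n
      induction n using Nat.strong_induction_on with
      | _ n ih =>
      rcases Nat.eq_zero_or_pos n with rfl | hn
      · rw [hb0]; exact (frobC_zero _ _ _).symm
      · have hq := hnonres lam hlam n hn
        have h1 := hz0 n
        have h2 := frobC_pos (fun j => fc j lam) (fun j => gc j lam) (α lam) n hn
        rw [eq_div_iff hq] at h2
        have h3 : ∑ k ∈ Finset.range n, ((k + α lam) * fc (n - k) lam + gc (n - k) lam) * b k
            = ∑ k ∈ Finset.range n, ((k + α lam) * fc (n - k) lam + gc (n - k) lam) * c lam k :=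
          Finset.sum_congr rfl fun k hk => by rw [ih k (Finset.mem_range.mp hk)]
        rw [h3] at h1
        apply mul_left_cancel₀ hq
        simp only [hc] at h1 ⊢
        linear_combination h1 - h2
    have h1 := hb z hz
    simp_rw [hbc] at h1
    exact h1.tsum_eq.symm
end
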